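/- Let f(X) ∈ ℚ(X) be a rational function of degree at least 2, and assume that neither f²(X) nor the conjugate (f²(X^{-1}))^{-1} is a polynomial. Let α ∈ ℚ be a wandering point for f, where f is regarded as a self-map of P¹(ℚ). Then for all sufficiently large n the point f^n(α) lies in ℚ, and writing f^n(α) = A_n/B_n with A_n, B_n ∈ ℤ coprime, one has lim_{n→∞} log|A_n| / log|B_n| = 1. -/

import Mathlib

attribute [local instance] Classical.propDecidable

open Filter

/-- Composition of rational functions: (f ∘ g)(X) = num_f(g(X)) / denom_f(g(X)). -/
noncomputable def rfComp {K : Type*} [Field K] (f g : RatFunc K) : RatFunc K :=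
  Polynomial.aeval g f.num / Polynomial.aeval g f.denom

/-- The n-th compositional iterate of a rational function; `rfIter f 0 = X`. -/
noncomputable def rfIter {K : Type*} [Field K] (f : RatFunc K) : ℕ → RatFunc K
  | 0 => RatFunc.X
  | n + 1 => rfComp f (rfIter f n)

/-- A rational function is a polynomial if it lies in the image of K[X] in K(X). -/
def RatFunc.IsPoly {K : Type*} [Field K] (f : RatFunc K) : Prop :=
  ∃ P : Polynomial K, f = algebraMap (Polynomial K) (RatFunc K) P

/-- The self-map of P¹(K) = K ∪ {∞} (modelled as `Option K`, with `none` = ∞) induced by a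
rational function f = num/denom. -/
noncomputable def P1map {K : Type*} [Field K] (f : RatFunc K) : Option K → Option K
  | some x =>
      if f.denom.eval x = 0 then none else some (f.num.eval x / f.denom.eval x)
  | none =>
      if f.denom.natDegree < f.num.natDegree then none
      else if f.num.natDegree < f.denom.natDegree then some 0
      else some (f.num.leadingCoeff / f.denom.leadingCoeff)

section DynamicalSiegel

open Polynomial

/-- The Wronskian determinant of linearly independent polynomials over a field of
characteristic zero does not vanish. -/
theorem det_iterate_derivative_ne_zero {K : Type*} [Field K] [CharZero K] {n : ℕ}
    (b : Fin n → K[X]) (hb : LinearIndependent K b) :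
    (Matrix.of fun i j : Fin n => derivative^[(i : ℕ)] (b j)).det ≠ 0 := by
  intro hdet
  obtain ⟨u, hu0, hu⟩ := Matrix.exists_vecMul_eq_zero_iff.mpr hdet
  obtain ⟨m, hm, hmax⟩ : ∃ m : Fin n, u m ≠ 0 ∧ ∀ i, m < i → u i = 0 := by
    have hne : (Finset.univ.filter fun i => u i ≠ 0).Nonempty := by
      obtain ⟨i, hi⟩ := Function.ne_iff.mp hu0
      exact ⟨i, by simpa using hi⟩
    refine ⟨_, (Finset.mem_filter.mp (Finset.max'_mem _ hne)).2, fun i hi => ?_⟩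
    by_contra h
    exact absurd (Finset.le_max' _ i (by simpa using h)) (not_le.mpr hi)
  obtain ⟨x₀, hx₀⟩ : ∃ x, (u m).eval x ≠ 0 := by
    by_contra! h
    exact hm (Polynomial.funext (by simpa using h))
  let T : (Fin n → K) →ₗ[K] (Fin m → K) := LinearMap.pi fun i =>
    (Polynomial.leval x₀) ∘ₗ (Polynomial.derivative ^ (i : ℕ)) ∘ₗ (Fintype.linearCombination K b)
  obtain ⟨c, hc, hc0⟩ : ∃ c, T c = 0 ∧ c ≠ 0 := by
    have : ¬ Function.Injective T := fun hinj => by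
      have := LinearMap.finrank_le_finrank_of_injective hinj
      simp at this
      omega
    rw [← LinearMap.ker_eq_bot, Submodule.eq_bot_iff] at this
    push Not at this
    exact this
  set v := ∑ j, c j • b j with hv
  have hv0 : v ≠ 0 := fun h => hc0 (funext (Fintype.linearIndependent_iff.mp hb c h))
  have hroot : ∀ i < (m : ℕ), (derivative^[i] v).IsRoot x₀ := fun i hi => by
    have := congrFun hc ⟨i, hi⟩
    simpa [T, Fintype.linearCombination_apply, Module.End.pow_apply, ← hv] using this
  set k := rootMultiplicity x₀ v with hk
  have hmk : (m : ℕ) ≤ k := by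
    rcases Nat.eq_zero_or_pos (m : ℕ) with h | h
    · omega
    · have := (lt_rootMultiplicity_iff_isRoot_iterate_derivative (n := (m : ℕ) - 1) hv0).mpr
        fun i hi => hroot i (by omega)
      omega
  have hsum : ∑ i : Fin n, u i * derivative^[(i : ℕ)] v = 0 := by
    have h1 : ∀ j, ∑ i : Fin n, u i * derivative^[(i : ℕ)] (b j) = 0 := fun j => by
      simpa [Matrix.vecMul, dotProduct] using congrFun hu j
    have h2 : ∀ i : Fin n, u i * derivative^[(i : ℕ)] v
        = ∑ j, c j • (u i * derivative^[(i : ℕ)] (b j)) := fun i => by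
      rw [hv, Polynomial.iterate_derivative_sum, Finset.mul_sum]
      refine Finset.sum_congr rfl fun j _ => ?_
      rw [Polynomial.iterate_derivative_smul, mul_smul_comm]
    simp_rw [h2]
    rw [Finset.sum_comm]
    simp [← Finset.smul_sum, h1]
  have hdvd : (X - C x₀) ^ (k - m + 1) ∣ derivative^[(m : ℕ)] v := by
    have hterm : ∀ i ∈ Finset.univ.erase m,
        (X - C x₀) ^ (k - m + 1) ∣ u i * derivative^[(i : ℕ)] v := fun i hi => by
      rcases lt_trichotomy i m with h | h | h
      · have h' : (i : ℕ) < m := h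
        exact ((pow_dvd_pow _ (by omega)).trans
          (pow_sub_dvd_iterate_derivative_of_pow_dvd _ (pow_rootMultiplicity_dvd v x₀))).mul_left _
      · simp [h] at hi
      · simp [hmax i h]
    rw [← Finset.add_sum_erase _ _ (Finset.mem_univ m)] at hsum
    have h1 : (X - C x₀) ^ (k - m + 1) ∣ u m * derivative^[(m : ℕ)] v := by
      rw [eq_neg_of_add_eq_zero_left hsum]
      exact (Finset.dvd_sum hterm).neg_right
    refine IsCoprime.dvd_of_dvd_mul_left ?_ h1
    refine IsCoprime.pow_left ?_
    exact (irreducible_X_sub_C x₀).coprime_iff_not_dvd.mpr (by rwa [dvd_iff_isRoot])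
  have h2 := pow_sub_dvd_iterate_derivative_of_pow_dvd (k - m) hdvd
  rw [← Function.iterate_add_apply, show k - m + 1 - (k - m) = 1 by omega, pow_one,
    Nat.sub_add_cancel hmk, dvd_iff_isRoot, IsRoot, hk, eval_iterate_derivative_rootMultiplicity,
    smul_eq_zero] at h2
  rcases h2 with h2 | h2
  · exact Nat.factorial_ne_zero _ h2
  · exact eval_divByMonic_pow_rootMultiplicity_ne_zero x₀ hv0 h2

/-- A bound for the total order of vanishing of elements of a finite-dimensional space of
polynomials of bounded degree. -/
theorem sum_order_le_finrank_mul {K : Type*} [Field K] [CharZero K] (V : Submodule K K[X])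
    [FiniteDimensional K V] {r : ℕ} (hr : ∀ v ∈ V, v.natDegree ≤ r) (S : Finset K) (t : K → ℕ)
    (hS : ∀ a ∈ S, ∃ v ∈ V, v ≠ 0 ∧ (X - C a) ^ t a ∣ v) :
    ∑ a ∈ S, (t a - (Module.finrank K V - 1)) ≤ Module.finrank K V * r := by
  obtain ⟨n, hn⟩ : ∃ n, Module.finrank K V = n := ⟨_, rfl⟩
  rw [hn]
  let B := Module.finBasisOfFinrankEq K V hn
  let b : Fin n → K[X] := fun j => (B j : K[X])
  have hb : LinearIndependent K b := B.linearIndependent.map' V.subtype V.ker_subtype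
  set M : Matrix (Fin n) (Fin n) K[X] :=
    Matrix.of fun i j : Fin n => derivative^[(i : ℕ)] (b j) with hM
  have hdet : M.det ≠ 0 := det_iterate_derivative_ne_zero b hb
  have hdeg : M.det.natDegree ≤ n * r := by
    rw [Matrix.det_apply]
    refine natDegree_sum_le_of_forall_le _ _ fun σ _ => ?_
    refine (natDegree_smul_le _ _).trans ((natDegree_prod_le _ _).trans ?_)
    refine (Finset.sum_le_card_nsmul _ _ r fun i _ => ?_).trans (by simp)
    exact (natDegree_iterate_derivative _ _).trans ((Nat.sub_le _ _).trans (hr _ (B i).2))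
  have hdvd : ∀ a ∈ S, (X - C a) ^ (t a - (n - 1)) ∣ M.det := fun a ha => by
    obtain ⟨v, hvV, hv0, hv⟩ := hS a ha
    set c := B.repr ⟨v, hvV⟩ with hc
    obtain ⟨j, hj⟩ : ∃ j, c j ≠ 0 := by
      by_contra! h
      have : c = 0 := Finsupp.ext h
      rw [hc, LinearEquiv.map_eq_zero_iff] at this
      exact hv0 (congrArg Subtype.val this)
    have hvsum : v = ∑ j, c j • b j := by
      have := congrArg Subtype.val (B.sum_repr ⟨v, hvV⟩)
      refine Eq.trans this.symm ?_
      simp only [b, AddSubmonoidClass.coe_finsetSum, Submodule.coe_smul, hc]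
    have hvec : M.mulVec (fun j => C (c j)) = fun i : Fin n => derivative^[(i : ℕ)] v := by
      ext1 i
      rw [hvsum, Polynomial.iterate_derivative_sum]
      simp only [Polynomial.iterate_derivative_smul]
      simp [Matrix.mulVec, dotProduct, hM, smul_eq_C_mul,
        mul_comm]
    have hadj : M.det * C (c j) = ∑ i, M.adjugate j i * derivative^[(i : ℕ)] v := by
      have h1 : M.adjugate.mulVec (M.mulVec (fun j => C (c j))) = M.det • fun j => C (c j) := by
        rw [Matrix.mulVec_mulVec, Matrix.adjugate_mul, Matrix.smul_mulVec, Matrix.one_mulVec]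
      have h2 := congrFun h1 j
      rw [hvec] at h2
      simpa [Matrix.mulVec, dotProduct] using h2.symm
    have h3 : (X - C a) ^ (t a - (n - 1)) ∣ M.det * C (c j) := by
      rw [hadj]
      refine Finset.dvd_sum fun i _ => Dvd.dvd.mul_left ?_ _
      exact (pow_dvd_pow _ (by omega)).trans (pow_sub_dvd_iterate_derivative_of_pow_dvd _ hv)
    exact (IsUnit.dvd_mul_right (isUnit_C.mpr (isUnit_iff_ne_zero.mpr hj))).mp h3
  have hprod : ∏ a ∈ S, (X - C a) ^ (t a - (n - 1)) ∣ M.det :=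
    Finset.prod_dvd_of_coprime (fun a _ a' _ h => IsCoprime.pow
      (pairwise_coprime_X_sub_C Function.injective_id h)) hdvd
  have h4 := natDegree_le_of_dvd hprod hdet
  rw [natDegree_prod_of_monic _ _ fun a _ => (monic_X_sub_C a).pow _] at h4
  simpa using h4.trans hdeg

theorem exists_pow_reduction_bound {p : ℤ[X]} (hp : p.Monic) (hD : 1 ≤ p.natDegree) :
    ∃ C : ℕ, 1 ≤ C ∧ ∃ ρ : ℕ → ℕ → ℤ, (∀ n k, |ρ n k| ≤ (C : ℤ) ^ n) ∧
      ∀ β : ℂ, aeval β p = 0 → ∀ n,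
        β ^ n = ∑ k ∈ Finset.range p.natDegree, (ρ n k : ℂ) * β ^ k := by
  set D := p.natDegree with hDdef
  have hp1 : p ≠ 1 := fun h => by rw [h] at hDdef; simp at hDdef; omega
  have hdeg : ∀ n, (X ^ n %ₘ p).natDegree < D := fun n => natDegree_modByMonic_lt _ hp hp1
  refine ⟨1 + ∑ k ∈ p.support, (p.coeff k).natAbs, by omega,
    fun n k => (X ^ n %ₘ p).coeff k, ?_, ?_⟩
  · have hcoef : ∀ k, |p.coeff k| ≤ ((∑ k ∈ p.support, (p.coeff k).natAbs : ℕ) : ℤ) := fun k => by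
      rw [Int.abs_eq_natAbs]
      by_cases hk : k ∈ p.support
      · exact_mod_cast Finset.single_le_sum (f := fun k => (p.coeff k).natAbs)
          (fun _ _ => Nat.zero_le _) hk
      · simp only [notMem_support_iff.mp hk]; positivity
    intro n
    induction n with
    | zero =>
      intro k
      have h1 : (X ^ 0 : ℤ[X]) %ₘ p = 1 := by
        rw [pow_zero, (modByMonic_eq_self_iff hp).mpr]
        rw [degree_one, degree_eq_natDegree hp.ne_zero]
        exact_mod_cast hD
      show |(X ^ 0 %ₘ p).coeff k| ≤ _
      rw [h1, coeff_one]
      split_ifs <;> simp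
    | succ n ih =>
      intro k
      set q := X ^ n %ₘ p with hq
      have h1 : X ^ (n + 1) %ₘ p = X * q - C (q.coeff (D - 1)) * p := by
        refine (div_modByMonic_unique (X * (X ^ n /ₘ p) + C (q.coeff (D - 1))) _ hp ⟨?_, ?_⟩).2
        · have := modByMonic_add_div (X ^ n : ℤ[X]) p
          rw [← hq] at this
          linear_combination X * this
        · rw [degree_eq_natDegree hp.ne_zero, degree_lt_iff_coeff_zero]
          intro m hm
          have hm : D ≤ m := hm
          obtain ⟨m', rfl⟩ : ∃ m', m = m' + 1 := ⟨m - 1, by omega⟩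
          rw [coeff_sub, coeff_C_mul, coeff_X_mul]
          rcases hm.eq_or_lt with h | h
          · have : p.coeff (m' + 1) = 1 := by rw [← h]; exact hp
            rw [this, h]; simp
          · rw [coeff_eq_zero_of_natDegree_lt (h.trans_le' hDdef.ge),
              coeff_eq_zero_of_natDegree_lt ((hdeg n).trans_le (by omega))]
            simp
      show |(X ^ (n + 1) %ₘ p).coeff k| ≤ _
      rw [h1, coeff_sub, coeff_C_mul]
      have h2 : |(X * q).coeff k| ≤ ((1 + ∑ k ∈ p.support, (p.coeff k).natAbs : ℕ) : ℤ) ^ n := by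
        cases k with
        | zero => rw [mul_coeff_zero, coeff_X_zero, zero_mul, abs_zero]; positivity
        | succ k => rw [coeff_X_mul]; exact ih k
      calc _ ≤ |(X * q).coeff k| + |q.coeff (D - 1) * p.coeff k| := abs_sub _ _
        _ ≤ _ := by
          rw [abs_mul, pow_succ]
          have := mul_le_mul (ih (D - 1)) (hcoef k) (abs_nonneg _) (by positivity)
          push_cast at *
          nlinarith
  · intro β hβ n
    have h1 := aeval_modByMonic_eq_self_of_root (p := X ^ n) hβ
    rw [map_pow, aeval_X] at h1
    rw [← h1, aeval_eq_sum_range' (hdeg n)]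
    simp

theorem X_sub_C_pow_dvd_iff_hasseDeriv {K : Type*} [Field K] (a : K) (t : ℕ) (Q : K[X]) :
    (X - C a) ^ t ∣ Q ↔ ∀ i < t, (hasseDeriv i Q).eval a = 0 := by
  simp_rw [← taylor_coeff]
  rw [← X_pow_dvd_iff]
  constructor
  · rintro ⟨w, rfl⟩
    rw [taylor_mul, taylor_pow]
    simp
  · rintro ⟨w, hw⟩
    refine ⟨taylor (-a) w, ?_⟩
    apply taylor_injective a
    rw [hw, taylor_mul, taylor_pow, taylor_taylor]
    simp

attribute [local instance] Matrix.seminormedAddCommGroup in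
theorem exists_auxiliary_polynomials {p : ℤ[X]} (hp : p.Monic) (hD : 1 ≤ p.natDegree)
    (s mm : ℕ) (hmm : 1 ≤ mm) : ∃ B : ℕ, 1 ≤ B ∧ ∀ k : ℕ, 1 ≤ k → ∃ P : Fin (s + 1) → ℤ[X],
      (∃ j, P j ≠ 0) ∧ (∀ j, (P j).natDegree ≤ p.natDegree * (mm + 1) * k) ∧
      (∀ j l, |(P j).coeff l| ≤ (B : ℤ) ^ k) ∧
      ∀ β : ℂ, aeval β p = 0 → (X - C β) ^ ((s + 1) * mm * k) ∣
        ∑ j : Fin (s + 1), C (β ^ (j : ℕ)) * (P j).map (Int.castRingHom ℂ) := by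
  obtain ⟨C₀, hC₀, ρ, hρ, hred⟩ := exists_pow_reduction_bound hp hD
  set D := p.natDegree
  set B₁ : ℕ := (s + 1) * 4 ^ (D * (mm + 1)) * C₀ ^ (D * (mm + 1) + s) with hB₁
  have hB₁1 : 1 ≤ B₁ := Nat.one_le_iff_ne_zero.mpr (by positivity)
  refine ⟨B₁ ^ mm, Nat.one_le_pow _ _ hB₁1, fun k hk => ?_⟩
  set r := D * (mm + 1) * k with hr
  set t := (s + 1) * mm * k with ht
  let A : Matrix (Fin t × Fin D) (Fin (s + 1) × Fin (r + 1)) ℤ := fun e u =>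
    ((u.2 : ℕ).choose e.1 : ℤ) * ρ (u.2 - e.1 + u.1) e.2
  have hA : ‖A‖ ≤ (2 : ℝ) ^ r * (C₀ : ℝ) ^ (r + s) := by
    rw [Matrix.norm_le_iff (by positivity)]
    intro e u
    rw [Int.norm_eq_abs]
    have h1 : |(u.2 : ℕ).choose e.1 * ρ (u.2 - e.1 + u.1) e.2| ≤
        (2 : ℤ) ^ r * (C₀ : ℤ) ^ (r + s) := by
      rw [abs_mul]
      refine mul_le_mul ?_ ((hρ _ _).trans ?_) (abs_nonneg _) (by positivity)
      · rw [abs_of_nonneg (by positivity)]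
        have := (Nat.choose_le_two_pow (u.2 : ℕ) e.1).trans
          (Nat.pow_le_pow_right (by norm_num) (by omega : (u.2 : ℕ) ≤ r))
        exact_mod_cast this
      · exact pow_le_pow_right₀ (by exact_mod_cast hC₀) (by omega)
    exact_mod_cast h1
  have hcard1 : Fintype.card (Fin t × Fin D) = (s + 1) * mm * k * D := by simp [ht]
  have hcard2 : Fintype.card (Fin (s + 1) × Fin (r + 1)) =
      (s + 1) * mm * k * D + ((s + 1) * D * k + (s + 1)) := by simp [hr]; ring
  obtain ⟨c, hc0, hAc, hc⟩ := Int.Matrix.exists_ne_zero_int_vec_norm_le A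
    (by rw [hcard1, hcard2]; omega) (by rw [hcard1]; positivity)
  have hcle : ∀ u, |c u| ≤ ((B₁ ^ mm : ℕ) : ℤ) ^ k := by
    intro u
    have h1 : ‖c u‖ ≤ ‖c‖ := norm_le_pi_norm c u
    have hbase1 : 1 ≤ (Fintype.card (Fin (s + 1) × Fin (r + 1)) : ℝ) * max 1 ‖A‖ := by
      refine one_le_mul_of_one_le_of_one_le ?_ (le_max_left _ _)
      rw [hcard2]; exact_mod_cast (by omega)
    have hbase : (Fintype.card (Fin (s + 1) × Fin (r + 1)) : ℝ) * max 1 ‖A‖ ≤ (B₁ : ℝ) ^ k := by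
      have h2 : max 1 ‖A‖ ≤ (2 : ℝ) ^ r * (C₀ : ℝ) ^ (r + s) := by
        refine max_le ?_ hA
        have : (1 : ℝ) ≤ C₀ := by exact_mod_cast hC₀
        exact one_le_mul_of_one_le_of_one_le (one_le_pow₀ (by norm_num)) (one_le_pow₀ this)
      have h3 : (Fintype.card (Fin (s + 1) × Fin (r + 1)) : ℝ) ≤ (s + 1 : ℝ) ^ k * 2 ^ r := by
        have h4 : r + 1 ≤ 2 ^ r := Nat.lt_two_pow_self
        have h5 : s + 1 ≤ (s + 1) ^ k := Nat.le_self_pow (by omega) _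
        have := Nat.mul_le_mul h5 h4
        simp only [Fintype.card_prod, Fintype.card_fin]
        exact_mod_cast this
      have h6 : (C₀ : ℝ) ^ (r + s) ≤ ((C₀ : ℝ) ^ (D * (mm + 1) + s)) ^ k := by
        rw [← pow_mul]
        refine pow_le_pow_right₀ (by exact_mod_cast hC₀) ?_
        rw [add_mul]
        have : s ≤ s * k := Nat.le_mul_of_pos_right _ hk
        omega
      calc _ ≤ ((s + 1 : ℝ) ^ k * 2 ^ r) * ((2 : ℝ) ^ r * ((C₀ : ℝ) ^ (D * (mm + 1) + s)) ^ k) := by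
            gcongr
            exact h2.trans (by gcongr)
        _ = _ := by
            rw [hB₁, hr]
            push_cast
            rw [mul_pow, mul_pow, ← pow_mul 4, show (4 : ℝ) = 2 * 2 by norm_num, mul_pow 2 2]
            ring
    have hexp : (Fintype.card (Fin t × Fin D) : ℝ) / ((Fintype.card (Fin (s + 1) × Fin (r + 1)) : ℝ)
        - Fintype.card (Fin t × Fin D)) ≤ mm := by
      rw [hcard1, hcard2]
      push_cast
      rw [add_sub_cancel_left, div_le_iff₀ (by positivity)]
      have : (0 : ℝ) ≤ mm * (s + 1) := by positivity
      nlinarith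
    have h7 : ‖c‖ ≤ ((B₁ : ℝ) ^ k) ^ mm := by
      refine hc.trans ((Real.rpow_le_rpow_of_exponent_le hbase1 hexp).trans ?_)
      rw [Real.rpow_natCast]
      gcongr
    have h8 := h1.trans h7
    rw [Int.norm_eq_abs, ← pow_mul, mul_comm k mm, pow_mul] at h8
    exact_mod_cast h8
  have hcoeff : ∀ j l, (∑ l : Fin (r + 1), monomial (l : ℕ) (c (j, l))).coeff l
      = if h : l < r + 1 then c (j, ⟨l, h⟩) else 0 := by
    intro j l
    simp only [finsetSum_coeff, coeff_monomial]
    split_ifs with h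
    · rw [Finset.sum_eq_single ⟨l, h⟩]
      · simp
      · intro b _ hb
        rw [if_neg]
        exact fun h' => hb (Fin.ext h')
      · simp
    · exact Finset.sum_eq_zero fun b _ => if_neg (by omega)
  refine ⟨fun j => ∑ l : Fin (r + 1), monomial (l : ℕ) (c (j, l)), ?_, ?_, ?_, ?_⟩
  · obtain ⟨⟨j, l⟩, hjl⟩ := Function.ne_iff.mp hc0
    refine ⟨j, fun h => hjl ?_⟩
    have := hcoeff j l
    simp only at h
    rw [h, dif_pos l.2] at this
    simpa using this.symm
  · intro j
    refine natDegree_sum_le_of_forall_le _ _ fun l _ => (natDegree_monomial_le _).trans (by omega)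
  · intro j l
    rw [hcoeff]
    split_ifs
    · exact hcle _
    · rw [abs_zero]; positivity
  · intro β hβ
    rw [X_sub_C_pow_dvd_iff_hasseDeriv]
    intro i hi
    have hterm : ∀ (j : Fin (s + 1)) (l : Fin (r + 1)),
        β ^ (j : ℕ) * ((c (j, l) : ℂ) * (((l : ℕ).choose i : ℂ) * β ^ ((l : ℕ) - i))) =
        ∑ κ : Fin D, ((A (⟨i, hi⟩, κ) (j, l) * c (j, l) : ℤ) : ℂ) * β ^ (κ : ℕ) := by
      intro j l
      have := hred β hβ ((l : ℕ) - i + j)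
      rw [Finset.sum_range] at this
      calc _ = (c (j, l) : ℂ) * ((l : ℕ).choose i : ℂ) * β ^ ((l : ℕ) - i + j) := by ring
        _ = _ := by
          rw [this, Finset.mul_sum]
          refine Finset.sum_congr rfl fun κ _ => ?_
          simp only [A]; push_cast; ring
    calc eval β (hasseDeriv i (∑ j : Fin (s + 1), C (β ^ (j : ℕ)) *
            (∑ l : Fin (r + 1), monomial (l : ℕ) (c (j, l))).map (Int.castRingHom ℂ)))
        = ∑ j : Fin (s + 1), ∑ l : Fin (r + 1),
          β ^ (j : ℕ) * ((c (j, l) : ℂ) * (((l : ℕ).choose i : ℂ) * β ^ ((l : ℕ) - i))) := by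
          rw [map_sum, eval_finsetSum]
          refine Finset.sum_congr rfl fun j _ => ?_
          rw [← smul_eq_C_mul, map_smul, eval_smul, Polynomial.map_sum, map_sum, eval_finsetSum,
            Finset.smul_sum]
          refine Finset.sum_congr rfl fun l _ => ?_
          rw [map_monomial, hasseDeriv_monomial, eval_monomial, smul_eq_mul]
          simp only [eq_intCast]; ring
      _ = ∑ κ : Fin D, ((A.mulVec c (⟨i, hi⟩, κ) : ℤ) : ℂ) * β ^ (κ : ℕ) := by
          simp_rw [hterm, Matrix.mulVec, dotProduct, Fintype.sum_prod_type]
          push_cast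
          simp_rw [Finset.sum_mul]
          rw [Finset.sum_comm (s := (Finset.univ : Finset (Fin D)))]
          exact Finset.sum_congr rfl fun j _ => Finset.sum_comm
      _ = 0 := by
          rw [hAc]; simp

theorem minpoly_int_root_facts {β : ℂ} (hβ : IsIntegral ℤ β) :
    ((minpoly ℤ β).aroots ℂ).toFinset.card = (minpoly ℤ β).natDegree ∧
    ∀ β' : ℂ, aeval β' (minpoly ℤ β) = 0 → ∀ q : ℤ[X], q.natDegree < (minpoly ℤ β).natDegree →
      aeval β' q = 0 → q = 0 := by
  have hmap : minpoly ℚ β = (minpoly ℤ β).map (algebraMap ℤ ℚ) :=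
    minpoly.isIntegrallyClosed_eq_field_fractions' ℚ hβ
  have hβQ : IsIntegral ℚ β := hβ.tower_top
  have hirr : Irreducible (minpoly ℚ β) := minpoly.irreducible hβQ
  have hmonic := minpoly.monic hβ
  have hnd : (minpoly ℚ β).natDegree = (minpoly ℤ β).natDegree := by
    rw [hmap, hmonic.natDegree_map]
  have hroot : ∀ (q : ℤ[X]) (x : ℂ), aeval x (q.map (algebraMap ℤ ℚ)) = aeval x q := fun q x =>
    aeval_map_algebraMap ℚ x q
  refine ⟨?_, ?_⟩
  · have h1 : (minpoly ℤ β).aroots ℂ = (minpoly ℚ β).aroots ℂ := by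
      rw [hmap, aroots_def, aroots_def, Polynomial.map_map]
      congr
    have h2 : ((minpoly ℚ β).aroots ℂ).Nodup :=
      nodup_aroots_iff_of_splits hirr.ne_zero (IsAlgClosed.splits _) |>.mpr hirr.separable
    rw [h1, Multiset.toFinset_card_of_nodup h2, aroots_def,
      ← (IsAlgClosed.splits ((minpoly ℚ β).map (algebraMap ℚ ℂ))).natDegree_eq_card_roots,
      natDegree_map, hnd]
  · intro β' hβ' q hq hq0
    by_contra hne
    have h1 : minpoly ℚ β = minpoly ℚ β' := minpoly.eq_of_irreducible_of_monic hirr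
      (by rw [hmap, hroot, hβ']) (minpoly.monic hβQ)
    have h2 : minpoly ℚ β' ∣ q.map (algebraMap ℤ ℚ) := minpoly.dvd _ _ (by rw [hroot, hq0])
    have h3 := natDegree_le_of_dvd h2 (by
      rwa [Ne, Polynomial.map_eq_zero_iff (algebraMap ℤ ℚ).injective_int])
    rw [← h1, hnd] at h3
    exact absurd (h3.trans natDegree_map_le) (not_le.mpr hq)

theorem exists_hasseDeriv_ne_zero {β : ℂ} (hβ : IsIntegral ℤ β) {s r t : ℕ}
    (hs : s < (minpoly ℤ β).natDegree) (P : Fin (s + 1) → ℤ[X]) (hP : ∃ j, P j ≠ 0)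
    (hdeg : ∀ j, (P j).natDegree ≤ r)
    (hdvd : ∀ β' : ℂ, aeval β' (minpoly ℤ β) = 0 → (X - C β') ^ t ∣
        ∑ j : Fin (s + 1), C (β' ^ (j : ℕ)) * (P j).map (Int.castRingHom ℂ))
    (hlarge : s * r < (minpoly ℤ β).natDegree * (t - s)) (x y : ℂ)
    (hx : aeval x (minpoly ℤ β) ≠ 0) (I : ℕ)
    (hI : (s + 1) * r < (minpoly ℤ β).natDegree * (t - s) + (I - s)) :
    ∃ i < I, (hasseDeriv i (∑ j : Fin (s + 1), C (y ^ (j : ℕ)) *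
      (P j).map (Int.castRingHom ℂ))).eval x ≠ 0 := by
  obtain ⟨hcard, hmin⟩ := minpoly_int_root_facts hβ
  set D := (minpoly ℤ β).natDegree
  set S := ((minpoly ℤ β).aroots ℂ).toFinset
  have hS : ∀ β' ∈ S, aeval β' (minpoly ℤ β) = 0 := fun β' h => by
    rw [Multiset.mem_toFinset, mem_aroots] at h
    exact h.2
  let v : Fin (s + 1) → ℂ[X] := fun j => (P j).map (Int.castRingHom ℂ)
  let V := Submodule.span ℂ (Set.range v)
  have hVdeg : ∀ w ∈ V, w.natDegree ≤ r := by
    intro w hw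
    have : V ≤ degreeLE ℂ r := Submodule.span_le.mpr (by
      rintro _ ⟨j, rfl⟩
      exact mem_degreeLE.mpr (degree_le_of_natDegree_le (natDegree_map_le.trans (hdeg j))))
    exact natDegree_le_of_degree_le (mem_degreeLE.mp (this hw))
  have hcomb : ∀ z : ℂ, ∑ j : Fin (s + 1), C (z ^ (j : ℕ)) * v j ∈ V := fun z =>
    Submodule.sum_mem _ fun j _ => by
      rw [← smul_eq_C_mul]
      exact V.smul_mem _ (Submodule.subset_span ⟨j, rfl⟩)
  have : FiniteDimensional ℂ V := FiniteDimensional.span_of_finite ℂ (Set.finite_range v)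
  have hne : ∀ β' ∈ S, ∑ j : Fin (s + 1), C (β' ^ (j : ℕ)) * v j ≠ 0 := by
    intro β' hβ' h0
    obtain ⟨j, hj⟩ := hP
    refine hj (Polynomial.ext fun l => ?_)
    have h1 := hmin β' (hS β' hβ') (∑ j : Fin (s + 1), monomial (j : ℕ) ((P j).coeff l))
      ((natDegree_sum_le_of_forall_le (n := s) _ _ fun j _ =>
        (natDegree_monomial_le _).trans (by omega)).trans_lt hs) (by
        have h2 := congrArg (fun w => w.coeff l) h0
        simp only [finsetSum_coeff, coeff_C_mul, v, coeff_map, coeff_zero] at h2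
        rw [map_sum, ← h2]
        refine Finset.sum_congr rfl fun j _ => ?_
        rw [aeval_monomial]
        simp [mul_comm])
    have h2 := congrArg (fun w => w.coeff (j : ℕ)) h1
    simp only [finsetSum_coeff, coeff_monomial, coeff_zero] at h2
    rw [Finset.sum_eq_single j (fun b _ hb => if_neg fun h => hb (Fin.ext h)) (by simp)] at h2
    simpa using h2
  have hle : Module.finrank ℂ V ≤ s + 1 := by
    have : Module.finrank ℂ V ≤ Fintype.card (Fin (s + 1)) := finrank_range_le_card (R := ℂ) v
    simpa using this
  have hrank : Module.finrank ℂ V = s + 1 := by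
    by_contra hlt
    have h1 := sum_order_le_finrank_mul V hVdeg S (fun _ => t) fun a ha =>
      ⟨_, hcomb a, hne a ha, hdvd a (hS a ha)⟩
    rw [Finset.sum_const, smul_eq_mul, hcard] at h1
    have h2 : D * (t - s) ≤ D * (t - (Module.finrank ℂ V - 1)) := Nat.mul_le_mul_left _ (by omega)
    have h3 : Module.finrank ℂ V * r ≤ s * r := Nat.mul_le_mul_right _ (by omega)
    omega
  have hli : LinearIndependent ℂ v := by
    rw [linearIndependent_iff_card_eq_finrank_span]
    simp only [Fintype.card_fin]
    exact hrank.symm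
  have hQ : ∑ j : Fin (s + 1), C (y ^ (j : ℕ)) * v j ≠ 0 := by
    intro h0
    simp_rw [← smul_eq_C_mul] at h0
    have := Fintype.linearIndependent_iff.mp hli _ h0 0
    simp at this
  by_contra! hcon
  have hxS : x ∉ S := fun h => hx (hS x h)
  have h1 := sum_order_le_finrank_mul V hVdeg (insert x S) (fun a => if a = x then I else t) (by
    intro a ha
    rcases eq_or_ne a x with rfl | h
    · refine ⟨_, hcomb y, hQ, ?_⟩
      simp only [if_true]
      exact (X_sub_C_pow_dvd_iff_hasseDeriv _ _ _).mpr hcon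
    · have ha := (Finset.mem_insert.mp ha).resolve_left h
      refine ⟨_, hcomb a, hne a ha, ?_⟩
      simp only [if_neg h]
      exact hdvd a (hS a ha))
  rw [Finset.sum_insert hxS, hrank, Finset.sum_congr rfl (g := fun _ => t - s) (fun a ha => by
    rw [if_neg (by rintro rfl; exact hxS ha), Nat.add_sub_cancel]), Finset.sum_const,
      smul_eq_mul, hcard] at h1
  simp only [if_true, Nat.add_sub_cancel] at h1
  omega

theorem norm_eval_hasseDeriv_le {Q : ℂ[X]} {r : ℕ} (hr : Q.natDegree ≤ r) {N M : ℝ}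
    (hN : ∀ l, ‖Q.coeff l‖ ≤ N) (hM : 1 ≤ M) {z : ℂ} (hz : ‖z‖ ≤ M) (i : ℕ) :
    ‖(hasseDeriv i Q).eval z‖ ≤ N * (4 * M) ^ r := by
  have hN0 : 0 ≤ N := (norm_nonneg _).trans (hN 0)
  have hd : (hasseDeriv i Q).natDegree < r + 1 :=
    ((natDegree_hasseDeriv_le Q i).trans (Nat.sub_le _ _)).trans_lt (by omega)
  rw [eval_eq_sum_range' hd]
  have h1 : ∀ l ∈ Finset.range (r + 1), ‖(hasseDeriv i Q).coeff l * z ^ l‖ ≤ 2 ^ r * N * M ^ r := by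
    intro l hl
    rw [norm_mul, norm_pow, hasseDeriv_coeff, norm_mul, Complex.norm_natCast]
    have hzl : ‖z‖ ^ l ≤ M ^ r := (pow_le_pow_left₀ (norm_nonneg _) hz l).trans
      (pow_le_pow_right₀ hM (by rw [Finset.mem_range] at hl; omega))
    rcases le_or_gt (l + i) r with h | h
    · have h2 : ((l + i).choose i : ℝ) ≤ 2 ^ r := by
        exact_mod_cast (Nat.choose_le_two_pow (l + i) i).trans
          (Nat.pow_le_pow_right (by norm_num) h)
      gcongr
      exact hN _
    · rw [coeff_eq_zero_of_natDegree_lt (hr.trans_lt h), norm_zero, mul_zero, zero_mul]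
      positivity
  refine (norm_sum_le_of_le _ h1).trans ?_
  rw [Finset.sum_const, Finset.card_range, nsmul_eq_mul]
  have h3 : ((r + 1 : ℕ) : ℝ) ≤ 2 ^ r := by
    exact_mod_cast (Nat.lt_two_pow_self : r < 2 ^ r)
  calc _ ≤ (2 : ℝ) ^ r * (2 ^ r * N * M ^ r) := by gcongr
    _ = _ := by rw [mul_pow, show (4 : ℝ) = 2 * 2 by norm_num, mul_pow]; ring

theorem norm_eval_hasseDeriv_le_of_pow_dvd {Q : ℂ[X]} {r t : ℕ} (hr : Q.natDegree ≤ r) {N : ℝ}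
    {β x : ℂ} (hN : ∀ l, ‖(hasseDeriv l Q).eval β‖ ≤ N) (ht : (X - C β) ^ t ∣ Q)
    (hx : ‖x - β‖ ≤ 1) (i : ℕ) :
    ‖(hasseDeriv i Q).eval x‖ ≤ N * 4 ^ r * ‖x - β‖ ^ (t - i) := by
  have hN0 : 0 ≤ N := (norm_nonneg _).trans (hN 0)
  have hvan : ∀ l < t, (hasseDeriv l Q).eval β = 0 := by
    obtain ⟨W, rfl⟩ := ht
    intro l hl
    rw [← taylor_coeff, taylor_mul, taylor_pow]
    simp [coeff_X_pow_mul', hl]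
  have hd : (taylor β (hasseDeriv i Q)).natDegree < r + 1 := by
    rw [natDegree_taylor]
    exact ((natDegree_hasseDeriv_le Q i).trans (Nat.sub_le _ _)).trans_lt (by omega)
  rw [show x = (x - β) + β by ring, ← taylor_eval, eval_eq_sum_range' hd, sub_add_cancel]
  have h1 : ∀ l ∈ Finset.range (r + 1), ‖(taylor β (hasseDeriv i Q)).coeff l * (x - β) ^ l‖ ≤
      2 ^ r * N * ‖x - β‖ ^ (t - i) := by
    intro l hl
    have hc : hasseDeriv l (hasseDeriv i Q) = (l + i).choose l • hasseDeriv (l + i) Q :=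
      LinearMap.congr_fun (hasseDeriv_comp (R := ℂ) l i) Q
    rw [taylor_coeff, hc, eval_smul, norm_mul, norm_pow, nsmul_eq_mul, norm_mul,
      Complex.norm_natCast]
    rcases lt_or_ge (l + i) t with h | h
    · rw [hvan _ h, norm_zero, mul_zero, zero_mul]
      positivity
    · rcases le_or_gt (l + i) r with h' | h'
      · have h2 : ((l + i).choose l : ℝ) ≤ 2 ^ r := by
          exact_mod_cast (Nat.choose_le_two_pow (l + i) l).trans
            (Nat.pow_le_pow_right (by norm_num) h')
        have h3 : ‖x - β‖ ^ l ≤ ‖x - β‖ ^ (t - i) :=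
          pow_le_pow_of_le_one (norm_nonneg _) hx (by omega)
        gcongr
        exact hN _
      · rw [hasseDeriv_eq_zero_of_lt_natDegree _ _ (hr.trans_lt h'), eval_zero, norm_zero, mul_zero,
          zero_mul]
        positivity
  refine (norm_sum_le_of_le _ h1).trans ?_
  rw [Finset.sum_const, Finset.card_range, nsmul_eq_mul]
  have h3 : ((r + 1 : ℕ) : ℝ) ≤ 2 ^ r := by
    exact_mod_cast (Nat.lt_two_pow_self : r < 2 ^ r)
  calc _ ≤ (2 : ℝ) ^ r * (2 ^ r * N * ‖x - β‖ ^ (t - i)) := by gcongr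
    _ = _ := by rw [show (4 : ℝ) = 2 * 2 by norm_num, mul_pow]; ring

theorem norm_pow_sub_pow_le {x y : ℂ} {M : ℝ} (hM : 1 ≤ M) (hx : ‖x‖ ≤ M) (hy : ‖y‖ ≤ M) {j s : ℕ}
    (hj : j ≤ s) : ‖x ^ j - y ^ j‖ ≤ s * M ^ s * ‖x - y‖ := by
  rw [← (Commute.all x y).geom_sum₂_mul, norm_mul]
  gcongr
  have h1 : ∀ l ∈ Finset.range j, ‖x ^ l * y ^ (j - 1 - l)‖ ≤ M ^ s := by
    intro l hl
    rw [Finset.mem_range] at hl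
    rw [norm_mul, norm_pow, norm_pow]
    calc _ ≤ M ^ l * M ^ (j - 1 - l) := by gcongr
      _ = M ^ (j - 1) := by rw [← pow_add]; congr 1; omega
      _ ≤ M ^ s := pow_le_pow_right₀ hM (by omega)
  refine (norm_sum_le_of_le _ h1).trans ?_
  rw [Finset.sum_const, Finset.card_range, nsmul_eq_mul]
  gcongr

/-- Clearing denominators: a nonzero two-variable value at rationals is not too small. -/
theorem one_le_mul_norm_of_ne_zero {s r : ℕ} (P : Fin (s + 1) → ℤ[X])
    (hdeg : ∀ j, (P j).natDegree ≤ r) (i : ℕ) (a₁ a₂ : ℤ) {b₁ b₂ : ℕ} (hb₁ : b₁ ≠ 0) (hb₂ : b₂ ≠ 0)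
    (h : (hasseDeriv i (∑ j : Fin (s + 1), C ((a₂ / b₂ : ℂ) ^ (j : ℕ)) *
      (P j).map (Int.castRingHom ℂ))).eval (a₁ / b₁ : ℂ) ≠ 0) :
    1 ≤ (b₁ : ℝ) ^ r * (b₂ : ℝ) ^ s *
      ‖(hasseDeriv i (∑ j : Fin (s + 1), C ((a₂ / b₂ : ℂ) ^ (j : ℕ)) *
      (P j).map (Int.castRingHom ℂ))).eval (a₁ / b₁ : ℂ)‖ := by
  have hb₁' : (b₁ : ℂ) ≠ 0 := by exact_mod_cast hb₁
  have hb₂' : (b₂ : ℂ) ≠ 0 := by exact_mod_cast hb₂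
  set z := (hasseDeriv i (∑ j : Fin (s + 1), C ((a₂ / b₂ : ℂ) ^ (j : ℕ)) *
      (P j).map (Int.castRingHom ℂ))).eval (a₁ / b₁ : ℂ) with hz
  let F : ℤ[X] := hasseDeriv i (∑ j : Fin (s + 1), C (a₂ ^ (j : ℕ) * (b₂ : ℤ) ^ (s - j)) * P j)
  have hF : F.natDegree ≤ r := ((natDegree_hasseDeriv_le _ i).trans (Nat.sub_le _ _)).trans
    (natDegree_sum_le_of_forall_le _ _ fun j _ => (natDegree_C_mul_le _ _).trans (hdeg j))
  have hmap : ∀ q : ℤ[X], (hasseDeriv i q).map (Int.castRingHom ℂ) =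
      hasseDeriv i (q.map (Int.castRingHom ℂ)) := by
    intro q
    ext l
    simp [hasseDeriv_coeff]
  obtain ⟨n, bi, hbi, hn⟩ := denomsClearable_of_natDegree_le (i := Int.castRingHom ℂ)
    (b := (b₁ : ℤ)) (bi := (b₁ : ℂ)⁻¹) r a₁ (by simp [hb₁']) F hF
  have hbi' : bi = (b₁ : ℂ)⁻¹ := by
    refine eq_inv_of_mul_eq_one_left ?_
    simpa using hbi
  have hFz : (F.map (Int.castRingHom ℂ)).eval (a₁ / b₁ : ℂ) = (b₂ : ℂ) ^ s * z := by
    rw [hmap, hz, ← smul_eq_mul, ← eval_smul, ← map_smul]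
    congr 2
    rw [Polynomial.map_sum, Finset.smul_sum]
    refine Finset.sum_congr rfl fun j _ => ?_
    rw [Polynomial.map_mul, map_C, smul_eq_C_mul, ← mul_assoc, ← C_mul]
    congr 2
    have : (b₂ : ℂ) ^ s = b₂ ^ (j : ℕ) * b₂ ^ (s - j) := by rw [← pow_add]; congr 1; omega
    rw [this, div_pow]
    simp only [eq_intCast]
    push_cast
    field_simp
  have hval : (n : ℂ) = (b₁ : ℂ) ^ r * ((b₂ : ℂ) ^ s * z) := by
    rw [← hFz, div_eq_mul_inv, ← hbi']
    simpa using hn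
  have hn0 : n ≠ 0 := by
    rintro rfl
    rw [Int.cast_zero] at hval
    exact (mul_ne_zero (pow_ne_zero _ hb₁') (mul_ne_zero (pow_ne_zero _ hb₂') h)) hval.symm
  have h1 : (1 : ℝ) ≤ ‖(n : ℂ)‖ := by
    rw [Complex.norm_intCast]
    exact_mod_cast Int.one_le_abs hn0
  rw [hval, norm_mul, norm_mul, norm_pow, norm_pow, Complex.norm_natCast,
    Complex.norm_natCast] at h1
  linarith

theorem thue_inequality {β : ℂ} (hβ : IsIntegral ℤ β) {s mm : ℕ}
    (hs : s < (minpoly ℤ β).natDegree) (hmm : 2 * s < mm) : ∃ C₂ : ℝ, 1 ≤ C₂ ∧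
    ∀ k : ℕ, 1 ≤ k → ∀ (a₁ a₂ : ℤ) (b₁ b₂ : ℕ), b₁ ≠ 0 → b₂ ≠ 0 →
      aeval (a₁ / b₁ : ℂ) (minpoly ℤ β) ≠ 0 → ‖(a₁ / b₁ : ℂ) - β‖ ≤ 1 → ‖(a₂ / b₂ : ℂ) - β‖ ≤ 1 →
      1 ≤ (b₁ : ℝ) ^ ((minpoly ℤ β).natDegree * (mm + 1) * k) * (b₂ : ℝ) ^ s *
        (C₂ ^ k * (‖(a₁ / b₁ : ℂ) - β‖ ^ ((s + 1) * mm * k -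
          ((s + 1) * (minpoly ℤ β).natDegree * k + s + (minpoly ℤ β).natDegree * s + 1)) +
          ‖(a₂ / b₂ : ℂ) - β‖)) := by
  set D := (minpoly ℤ β).natDegree
  obtain ⟨B, hB, hP⟩ := exists_auxiliary_polynomials (minpoly.monic hβ) (show 1 ≤ D by omega)
    s mm (by omega)
  set M := ‖β‖ + 1
  have hM : 1 ≤ M := by simp [M]
  have hBr : (1 : ℝ) ≤ B := by exact_mod_cast hB
  set C₁ : ℝ := (s + 1) * (s + 1) * M ^ s with hC₁
  have hC₁1 : 1 ≤ C₁ := by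
    have h1 : (1 : ℝ) ≤ s + 1 := by simp
    exact one_le_mul_of_one_le_of_one_le (one_le_mul_of_one_le_of_one_le h1 h1) (one_le_pow₀ hM)
  set E : ℝ := (16 * M) ^ (D * (mm + 1))
  have hE : 1 ≤ E := one_le_pow₀ (by linarith)
  refine ⟨C₁ * B * E, one_le_mul_of_one_le_of_one_le
    (one_le_mul_of_one_le_of_one_le hC₁1 hBr) hE, ?_⟩
  intro k hk a₁ a₂ b₁ b₂ hb₁ hb₂ hroot h1 h2
  obtain ⟨P, hP0, hPdeg, hPcoeff, hPdvd⟩ := hP k hk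
  set r := D * (mm + 1) * k with hr
  set t := (s + 1) * mm * k with ht
  set I := (s + 1) * D * k + s + D * s + 1 with hI
  set x : ℂ := a₁ / b₁
  set y : ℂ := a₂ / b₂ with hy
  have hD : 1 ≤ D := by omega
  have hst : s ≤ t := by
    have : s + 1 ≤ (s + 1) * (mm * k) := Nat.le_mul_of_pos_right _ (Nat.mul_pos (by omega) hk)
    rw [← mul_assoc] at this
    omega
  obtain ⟨i, hiI, hi⟩ := exists_hasseDeriv_ne_zero hβ hs P hP0 hPdeg hPdvd (by
      show s * r < D * (t - s)
      have h3 : s * ((mm + 1) * k) < t - s := by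
        have h4 : (2 * s + 1) * k ≤ mm * k := Nat.mul_le_mul_right _ hmm
        have h5 : s * k ≥ s := Nat.le_mul_of_pos_right _ hk
        have h6 : t + s * k = s * ((mm + 1) * k) + mm * k := by rw [ht]; ring
        have h7 : (2 * s + 1) * k = s * k + s * k + k := by ring
        omega
      calc s * r = D * (s * ((mm + 1) * k)) := by rw [hr]; ring
        _ < _ := Nat.mul_lt_mul_of_pos_left h3 hD) x y hroot I (by
      show (s + 1) * r < D * (t - s) + (I - s)
      have h3 : I - s = (s + 1) * D * k + D * s + 1 := by omega
      rw [h3, Nat.mul_sub]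
      have h4 : D * s ≤ D * t := Nat.mul_le_mul_left _ hst
      have h5 : (s + 1) * r = D * t + (s + 1) * D * k := by rw [hr, ht]; ring
      omega)
  have hlow := one_le_mul_norm_of_ne_zero P hPdeg i a₁ a₂ hb₁ hb₂ hi
  refine hlow.trans (mul_le_mul_of_nonneg_left ?_ (by positivity))
  rw [← hy]
  set Qy : ℂ[X] := ∑ j : Fin (s + 1), C (y ^ (j : ℕ)) * (P j).map (Int.castRingHom ℂ) with hQy
  set Qβ : ℂ[X] := ∑ j : Fin (s + 1), C (β ^ (j : ℕ)) * (P j).map (Int.castRingHom ℂ) with hQβ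
  have hcoef : ∀ (j : Fin (s + 1)) l, ‖((P j).coeff l : ℂ)‖ ≤ (B : ℝ) ^ k := by
    intro j l
    rw [Complex.norm_intCast]
    exact_mod_cast hPcoeff j l
  have hdegs : ∀ g : Fin (s + 1) → ℂ,
      (∑ j : Fin (s + 1), C (g j) * (P j).map (Int.castRingHom ℂ)).natDegree ≤ r := fun g =>
    natDegree_sum_le_of_forall_le _ _ fun j _ =>
      (natDegree_C_mul_le _ _).trans (natDegree_map_le.trans (hPdeg j))
  have hsum : ∀ (g : Fin (s + 1) → ℂ) (K : ℝ), (∀ j, ‖g j‖ ≤ K) → ∀ l,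
      ‖(∑ j : Fin (s + 1), C (g j) * (P j).map (Int.castRingHom ℂ)).coeff l‖ ≤
        (s + 1) * (K * (B : ℝ) ^ k) := by
    intro g K hg l
    rw [finsetSum_coeff]
    have h3 : ∀ j ∈ (Finset.univ : Finset (Fin (s + 1))),
        ‖(C (g j) * (P j).map (Int.castRingHom ℂ)).coeff l‖ ≤ K * (B : ℝ) ^ k := by
      intro j _
      rw [coeff_C_mul, coeff_map, norm_mul]
      exact mul_le_mul (hg j) (hcoef j l) (norm_nonneg _) ((norm_nonneg _).trans (hg j))
    refine (norm_sum_le_of_le _ h3).trans ?_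
    simp
  have hβM : ‖β‖ ≤ M := by simp [M]
  have hnear : ∀ z : ℂ, ‖z - β‖ ≤ 1 → ‖z‖ ≤ M := fun z hz => by
    have := norm_add_le (z - β) β
    rw [sub_add_cancel] at this
    linarith
  have hdiff : Qy = Qβ + ∑ j : Fin (s + 1), C (y ^ (j : ℕ) - β ^ (j : ℕ)) *
      (P j).map (Int.castRingHom ℂ) := by
    rw [hQy, hQβ, ← Finset.sum_add_distrib]
    refine Finset.sum_congr rfl fun j _ => ?_
    rw [C_sub]; ring
  have hbd1 : ‖(hasseDeriv i Qβ).eval x‖ ≤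
      ((s + 1) * (M ^ s * (B : ℝ) ^ k) * (4 * M) ^ r) * 4 ^ r * ‖x - β‖ ^ (t - i) :=
    norm_eval_hasseDeriv_le_of_pow_dvd (hdegs _)
      (fun l => norm_eval_hasseDeriv_le (hdegs _) (hsum _ _ fun j => by
        rw [norm_pow]
        exact (pow_le_pow_left₀ (norm_nonneg _) hβM _).trans
          (pow_le_pow_right₀ hM (by omega))) hM hβM l)
      (hPdvd β (minpoly.aeval ℤ β)) h1 i
  have hbd2 := norm_eval_hasseDeriv_le (hdegs (fun j => y ^ (j : ℕ) - β ^ (j : ℕ)))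
    (hsum _ _ fun j => norm_pow_sub_pow_le hM (hnear y h2) hβM (show (j : ℕ) ≤ s by omega))
    hM (hnear x h1) i
  have hpow : ‖x - β‖ ^ (t - i) ≤ ‖x - β‖ ^ (t - I) :=
    pow_le_pow_of_le_one (norm_nonneg _) h1 (by omega)
  have hC : (s + 1) * (s + 1) * M ^ s * (B : ℝ) ^ k * (16 * M) ^ r ≤ (C₁ * B * E) ^ k := by
    rw [mul_pow (C₁ * B) E k, mul_pow C₁ _ k, ← hC₁, hr, pow_mul (16 * M)]
    have := le_self_pow₀ hC₁1 (show k ≠ 0 by omega)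
    gcongr
  have h16 : (4 * M) ^ r * 4 ^ r = (16 * M) ^ r := by
    rw [← mul_pow]; ring
  have h4 : (4 * M) ^ r ≤ (16 * M) ^ r := by gcongr; norm_num
  rw [hdiff, map_add, eval_add]
  refine (norm_add_le _ _).trans ?_
  set δ := ‖x - β‖ ^ (t - I)
  have hs0 : (0 : ℝ) ≤ s := by positivity
  calc _ ≤ (s + 1) * (M ^ s * (B : ℝ) ^ k) * (4 * M) ^ r * 4 ^ r * δ +
        (s + 1) * (s * M ^ s * ‖y - β‖ * (B : ℝ) ^ k) * (4 * M) ^ r := by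
        refine add_le_add (hbd1.trans ?_) hbd2
        gcongr
    _ ≤ (s + 1) * (s + 1) * M ^ s * (B : ℝ) ^ k * (16 * M) ^ r * δ +
        (s + 1) * (s + 1) * M ^ s * (B : ℝ) ^ k * (16 * M) ^ r * ‖y - β‖ := by
        refine add_le_add ?_ ?_
        · rw [mul_assoc (_ * (_ * _)) _ (4 ^ r), h16]
          have : (s + 1) * (M ^ s * (B : ℝ) ^ k) ≤ (s + 1) * (s + 1) * M ^ s * (B : ℝ) ^ k := by
            have : (0 : ℝ) ≤ (M ^ s * (B : ℝ) ^ k) := by positivity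
            nlinarith [mul_nonneg hs0 this, mul_nonneg hs0 (mul_nonneg hs0 this)]
          gcongr
        · calc (s + 1) * (s * M ^ s * ‖y - β‖ * (B : ℝ) ^ k) * (4 * M) ^ r
              = (s + 1) * s * M ^ s * (B : ℝ) ^ k * (4 * M) ^ r * ‖y - β‖ := by ring
            _ ≤ _ := by gcongr; linarith
    _ = (s + 1) * (s + 1) * M ^ s * (B : ℝ) ^ k * (16 * M) ^ r * (δ + ‖y - β‖) := by ring
    _ ≤ _ := by gcongr

set_option maxHeartbeats 1000000 in
/-- The Thue–Siegel theorem, for algebraic integers. -/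
theorem thue_siegel_of_isIntegral {β : ℂ} (hβ : IsIntegral ℤ β) {s : ℕ}
    (hs : s < (minpoly ℤ β).natDegree) {κ : ℝ}
    (hκ : s + (minpoly ℤ β).natDegree / (s + 1 : ℝ) < κ) :
    ∃ Q₀ : ℕ, ∀ (a : ℤ) (b : ℕ), Q₀ ≤ b → aeval (a / b : ℂ) (minpoly ℤ β) ≠ 0 →
      (b : ℝ) ^ (-κ) ≤ ‖(a / b : ℂ) - β‖ := by
  set D := (minpoly ℤ β).natDegree with hDdef
  by_contra! hbad
  have hs1 : (0 : ℝ) < s + 1 := by positivity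
  have hκs : (s : ℝ) < κ := lt_of_le_of_lt (by simp; positivity) hκ
  have hκ0 : 0 < κ := lt_of_le_of_lt (by positivity) hκs
  set g : ℝ := κ * (s + 1) - D - s * (s + 1) with hg
  have hg0 : 0 < g := by
    have h1 := mul_lt_mul_of_pos_right hκ hs1
    rw [add_mul, div_mul_cancel₀ _ hs1.ne'] at h1
    linarith
  obtain ⟨m₀, hm₀⟩ := exists_nat_ge ((D + κ * (s + 1) * D + 2) / g)
  rw [div_le_iff₀ hg0] at hm₀
  set mm : ℕ := m₀ + 2 * s + D + (D + 1) * s + 1 with hmmdef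
  have hmm : (D + κ * (s + 1) * D + 2 : ℝ) ≤ mm * g := by
    refine hm₀.trans (mul_le_mul_of_nonneg_right ?_ hg0.le)
    exact_mod_cast (by omega : m₀ ≤ mm)
  obtain ⟨C₂, hC₂, hmain⟩ := thue_inequality hβ hs (show 2 * s < mm by omega)
  have hsmall : ∀ (a : ℤ) (b : ℕ), 1 ≤ b → ‖(a / b : ℂ) - β‖ < (b : ℝ) ^ (-κ) →
      ‖(a / b : ℂ) - β‖ ≤ 1 := fun a b hb h => h.le.trans
    (Real.rpow_le_one_of_one_le_of_nonpos (by exact_mod_cast hb) (by linarith))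
  obtain ⟨q₁, hq₁⟩ := exists_nat_gt (2 * C₂)
  obtain ⟨a₁, b₁, hb₁q, hroot₁, hclose₁⟩ := hbad (q₁ + 2)
  have hb₁C : 2 * C₂ < b₁ := hq₁.trans_le (by exact_mod_cast (by omega : q₁ ≤ b₁))
  set N := (s + 1) * mm with hN
  have hN1 : 1 ≤ N := Nat.mul_pos (by omega) (by omega)
  obtain ⟨k₀, hk₀⟩ := exists_nat_ge ((s * N : ℝ) + κ * ((D + 1) * s + 1))
  obtain ⟨a₂, b₂, hb₂q, -, hclose₂⟩ := hbad ((b₁ ^ N) ^ (k₀ + 1))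
  have hb₁N : 1 < b₁ ^ N := Nat.one_lt_pow (by omega) (by omega)
  have hb₂1 : 1 ≤ b₂ := (Nat.one_le_pow _ _ hb₁N.le).trans hb₂q
  set k := Nat.log (b₁ ^ N) b₂ with hk
  have hkk₀ : k₀ + 1 ≤ k := Nat.le_log_of_pow_le hb₁N hb₂q
  have hle1 : (b₁ ^ N) ^ k ≤ b₂ := Nat.pow_log_le_self _ (by omega)
  have hle2 : b₂ ≤ (b₁ ^ N) ^ (k + 1) := (Nat.lt_pow_succ_log_self hb₁N _).le
  have key := hmain k (by omega) a₁ a₂ b₁ b₂ (by omega) (by omega) hroot₁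
    (hsmall _ _ (by omega) hclose₁) (hsmall _ _ hb₂1 hclose₂)
  have hb₁r : (0 : ℝ) < b₁ := by exact_mod_cast (by omega : 0 < b₁)
  have hb₂r : (0 : ℝ) < b₂ := by exact_mod_cast (by omega : 0 < b₂)
  set L₁ := Real.log b₁ with hL₁
  set L₂ := Real.log b₂ with hL₂
  have hL₁0 : 0 < L₁ := Real.log_pos (by exact_mod_cast (by omega : 1 < b₁))
  have hL1 : N * k * L₁ ≤ L₂ := by
    have : ((b₁ ^ N) ^ k : ℝ) ≤ b₂ := by exact_mod_cast hle1
    have := Real.log_le_log (by positivity) this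
    rw [Real.log_pow, Real.log_pow] at this
    linarith
  have hL2 : L₂ ≤ N * (k + 1) * L₁ := by
    have : (b₂ : ℝ) ≤ ((b₁ ^ N) ^ (k + 1) : ℝ) := by exact_mod_cast hle2
    have := Real.log_le_log hb₂r this
    rw [Real.log_pow, Real.log_pow] at this
    push_cast at this
    linarith
  set T := (s + 1) * mm * k - ((s + 1) * D * k + s + D * s + 1) with hT
  have hTr : (T : ℝ) = (s + 1) * mm * k - ((s + 1) * D * k + s + D * s + 1) := by
    rw [hT, Nat.cast_sub]
    · push_cast; ring
    · have h1 : (D + (D + 1) * s + 1) * k ≤ mm * k := Nat.mul_le_mul_right _ (by omega)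
      have h2 : (D + 1) * s + 1 ≤ ((D + 1) * s + 1) * k := Nat.le_mul_of_pos_right _ (by omega)
      have h3 : (s + 1) * ((D + (D + 1) * s + 1) * k) ≤ (s + 1) * (mm * k) :=
        Nat.mul_le_mul_left _ h1
      have h4 : ((D + 1) * s + 1) * k ≤ (s + 1) * (((D + 1) * s + 1) * k) :=
        Nat.le_mul_of_pos_left _ (by omega)
      nlinarith
  have hkr : (k₀ : ℝ) ≤ k := by exact_mod_cast (by omega : k₀ ≤ k)
  have hNr : (N : ℝ) = (s + 1) * mm := by rw [hN]; push_cast; ring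
  have hk0 : (0 : ℝ) ≤ k := by positivity
  have hD0 : (0 : ℝ) ≤ D := by positivity
  have hs0 : (0 : ℝ) ≤ s := by positivity
  have hδ₁ : ‖(a₁ / b₁ : ℂ) - β‖ ^ T ≤ Real.exp (-(κ * T) * L₁) := by
    refine (pow_le_pow_left₀ (norm_nonneg _) hclose₁.le T).trans (le_of_eq ?_)
    rw [← Real.rpow_natCast, ← Real.rpow_mul hb₁r.le, Real.rpow_def_of_pos hb₁r]
    congr 1
    ring
  have hδ₂ : ‖(a₂ / b₂ : ℂ) - β‖ ≤ Real.exp (-κ * L₂) := by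
    refine hclose₂.le.trans (le_of_eq ?_)
    rw [Real.rpow_def_of_pos hb₂r]
    congr 1
    ring
  have hprod : (b₁ : ℝ) ^ (D * (mm + 1) * k) * (b₂ : ℝ) ^ s =
      Real.exp (D * (mm + 1) * k * L₁ + s * L₂) := by
    rw [Real.exp_add, ← Real.exp_log (pow_pos hb₁r (D * (mm + 1) * k)),
      ← Real.exp_log (pow_pos hb₂r s), Real.log_pow, Real.log_pow]
    push_cast
    rfl
  have hc1 : D * (mm + 1) * k * L₁ + s * L₂ + -(κ * T) * L₁ ≤ -(k * L₁) := by
    have h1 : s * L₂ ≤ s * (N * (k + 1) * L₁) := mul_le_mul_of_nonneg_left hL2 hs0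
    have h2 : D * (mm + 1) * k + s * (N * (k + 1)) - κ * T ≤ -(k : ℝ) := by
      have h3 : D * (mm + 1) * k + s * (N * (k + 1)) - κ * T =
          k * (D + κ * (s + 1) * D - mm * g) + (s * N + κ * ((D + 1) * s + 1)) := by
        rw [hTr, hg, hNr]; ring
      have h4 := mul_le_mul_of_nonneg_left
        (show (D + κ * (s + 1) * D - mm * g : ℝ) ≤ -2 by linarith) hk0
      rw [h3]
      linarith
    have h5 := mul_le_mul_of_nonneg_right h2 hL₁0.le
    linarith
  have hc2 : D * (mm + 1) * k * L₁ + s * L₂ + -κ * L₂ ≤ -(k * L₁) := by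
    have h1 : (κ - s) * (N * k * L₁) ≤ (κ - s) * L₂ :=
      mul_le_mul_of_nonneg_left hL1 (by linarith)
    have h2 : D * (mm + 1) * k - (κ - s) * (N * k) ≤ -(k : ℝ) := by
      have h3 : D * (mm + 1) * k - (κ - s) * (N * k) = k * (D - mm * g) := by
        rw [hg, hNr]; ring
      have h4 : 0 ≤ κ * (s + 1) * D := by positivity
      have h5 := mul_le_mul_of_nonneg_left (show (D - mm * g : ℝ) ≤ -2 by linarith) hk0
      rw [h3]
      linarith
    have h6 := mul_le_mul_of_nonneg_right h2 hL₁0.le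
    linarith
  have hfin : 1 ≤ C₂ ^ k * (2 * Real.exp (-(k * L₁))) := by
    refine key.trans ?_
    rw [hprod, mul_left_comm]
    refine mul_le_mul_of_nonneg_left ?_ (by positivity)
    rw [mul_add, two_mul]
    refine add_le_add ?_ ?_
    · refine (mul_le_mul_of_nonneg_left hδ₁ (Real.exp_pos _).le).trans ?_
      rw [← Real.exp_add]
      exact Real.exp_le_exp.mpr hc1
    · refine (mul_le_mul_of_nonneg_left hδ₂ (Real.exp_pos _).le).trans ?_
      rw [← Real.exp_add]
      exact Real.exp_le_exp.mpr hc2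
  have hexp : Real.exp (-(k * L₁)) = ((b₁ : ℝ) ^ k)⁻¹ := by
    rw [Real.exp_neg, Real.exp_nat_mul, hL₁, Real.exp_log hb₁r]
  rw [hexp, ← mul_assoc, ← div_eq_mul_inv, le_div_iff₀ (by positivity), one_mul] at hfin
  have h1 : (2 * C₂) ^ k < (b₁ : ℝ) ^ k := pow_lt_pow_left₀ hb₁C (by linarith) (by omega)
  have h2 : (2 : ℝ) ≤ 2 ^ k := by
    calc (2 : ℝ) = 2 ^ 1 := by norm_num
      _ ≤ _ := pow_le_pow_right₀ (by norm_num) (by omega)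
  rw [mul_pow] at h1
  have h3 : 0 < C₂ ^ k := by positivity
  nlinarith

/-- The Thue–Siegel theorem. -/
theorem thue_siegel {β : ℂ} (hβ : IsAlgebraic ℚ β) {s : ℕ}
    (hs : s < (minpoly ℚ β).natDegree) {κ : ℝ}
    (hκ : s + (minpoly ℚ β).natDegree / (s + 1 : ℝ) < κ) :
    ∃ Q₀ : ℕ, ∀ (a : ℤ) (b : ℕ), Q₀ ≤ b → (a / b : ℂ) ≠ β →
      (b : ℝ) ^ (-κ) ≤ ‖(a / b : ℂ) - β‖ := by
  obtain ⟨c, hc0, hc⟩ :=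
    ((IsFractionRing.isAlgebraic_iff ℤ ℚ ℂ).mpr hβ).exists_integral_multiple
  set γ : ℂ := c • β with hγ
  have hγ' : γ = c * β := by rw [hγ, zsmul_eq_mul]
  have hc0' : (c : ℂ) ≠ 0 := by exact_mod_cast hc0
  have hmin : minpoly ℚ γ = (minpoly ℤ γ).map (algebraMap ℤ ℚ) :=
    minpoly.isIntegrallyClosed_eq_field_fractions' ℚ hc
  have hγQ : IsIntegral ℚ γ := hc.tower_top
  have hdeg : (minpoly ℤ γ).natDegree = (minpoly ℚ β).natDegree := by
    rw [← (minpoly.monic hc).natDegree_map (algebraMap ℤ ℚ), ← hmin,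
      ← IntermediateField.adjoin.finrank hγQ, ← IntermediateField.adjoin.finrank hβ.isIntegral]
    suffices IntermediateField.adjoin ℚ {γ} = IntermediateField.adjoin ℚ {β} by rw [this]
    apply le_antisymm
    · rw [IntermediateField.adjoin_simple_le_iff, hγ]
      exact zsmul_mem (IntermediateField.mem_adjoin_simple_self ℚ β) c
    · rw [IntermediateField.adjoin_simple_le_iff]
      have : β = γ / c := by rw [hγ']; field_simp
      rw [this]
      exact div_mem (IntermediateField.mem_adjoin_simple_self ℚ γ) (intCast_mem _ c)
  obtain ⟨κ', hκ1, hκ2⟩ := exists_between hκ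
  obtain ⟨Q₁, hQ₁⟩ := thue_siegel_of_isIntegral hc (s := s) (by rwa [hdeg]) (κ := κ')
    (by rwa [hdeg])
  have htend : Filter.Tendsto (fun b : ℕ => (b : ℝ) ^ (κ - κ')) Filter.atTop Filter.atTop :=
    (tendsto_rpow_atTop (by linarith)).comp tendsto_natCast_atTop_atTop
  obtain ⟨Q₂, hQ₂⟩ := Filter.eventually_atTop.mp (htend.eventually_ge_atTop |(c : ℝ)|)
  refine ⟨max (max Q₁ Q₂) 1, fun a b hb hne => ?_⟩
  have h1 := hQ₁ (c * a) b (by omega) (by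
    intro h0
    apply hne
    have h2 : aeval (algebraMap ℚ ℂ (c * a / b)) (minpoly ℚ γ) = 0 := by
      rw [hmin, aeval_map_algebraMap, ← h0]
      congr 1
      push_cast
      simp
    have h3 := minpoly.eq_of_irreducible_of_monic (minpoly.irreducible hγQ) h2 (minpoly.monic hγQ)
    rw [minpoly.eq_X_sub_C] at h3
    have h4 := minpoly.aeval ℚ γ
    rw [h3, map_sub, aeval_X, aeval_C, sub_eq_zero, hγ'] at h4
    have : β = a / b := by
      apply mul_left_cancel₀ hc0'
      rw [h4]; push_cast; simp; ring
    exact this.symm)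
  have h2 : ((c * a : ℤ) / b : ℂ) - γ = c * (a / b - β) := by rw [hγ']; push_cast; ring
  rw [h2, norm_mul, Complex.norm_intCast] at h1
  have hb0 : (0 : ℝ) < b := by exact_mod_cast (by omega : 0 < b)
  have hcpos : 0 < |(c : ℝ)| := by simpa using hc0
  have h3 : |(c : ℝ)| * (b : ℝ) ^ (-κ) ≤ (b : ℝ) ^ (-κ') := by
    calc _ ≤ (b : ℝ) ^ (κ - κ') * (b : ℝ) ^ (-κ) := by
          gcongr
          exact hQ₂ b (by omega)
      _ = _ := by rw [← Real.rpow_add hb0]; congr 1; ring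
  exact le_of_mul_le_mul_left (h3.trans h1) hcpos

section FormEval
variable {K R S : Type*} [Field K] [CommRing R] [Algebra K R] [CommRing S] [Algebra K S]

/-- The value at `(a, b)` of the degree-`d` homogenization of `F`. -/
noncomputable def formEval (d : ℕ) (F : K[X]) (a b : R) : R :=
  MvPolynomial.aeval ![a, b] (F.homogenize d)

theorem formEval_eq_sum (d : ℕ) (F : K[X]) (a b : R) : formEval d F a b =
    ∑ i ∈ Finset.range (d + 1), algebraMap K R (F.coeff i) * a ^ i * b ^ (d - i) := by
  rw [formEval, homogenize, map_sum, Finset.Nat.sum_antidiagonal_eq_sum_range_succ_mk]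
  refine Finset.sum_congr rfl fun i _ => ?_
  rw [MvPolynomial.aeval_monomial, Finsupp.prod_fintype _ _ (by simp)]
  simp [mul_assoc]

theorem map_formEval (φ : R →ₐ[K] S) (d : ℕ) (F : K[X]) (a b : R) :
    φ (formEval d F a b) = formEval d F (φ a) (φ b) := by
  simp [formEval_eq_sum]

theorem formEval_mul_mul (d : ℕ) (F : K[X]) (c a b : R) :
    formEval d F (c * a) (c * b) = c ^ d * formEval d F a b := by
  simp only [formEval_eq_sum, Finset.mul_sum]
  refine Finset.sum_congr rfl fun i hi => ?_
  have : c ^ d = c ^ i * c ^ (d - i) := by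
    rw [← pow_add]; congr 1; rw [Finset.mem_range] at hi; omega
  rw [this]; ring

theorem formEval_one_right {d : ℕ} {F : K[X]} (hF : F.natDegree ≤ d) (a : R) :
    formEval d F a 1 = aeval a F := by
  rw [formEval_eq_sum, aeval_eq_sum_range' (Nat.lt_succ_of_le hF)]
  simp [Algebra.smul_def]

theorem formEval_reflect (d : ℕ) (F : K[X]) (a b : R) :
    formEval d (reflect d F) a b = formEval d F b a := by
  rw [formEval_eq_sum, formEval_eq_sum, ← Finset.sum_range_reflect]
  refine Finset.sum_congr rfl fun i hi => ?_
  have hi : i ≤ d := by rw [Finset.mem_range] at hi; omega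
  rw [coeff_reflect, revAt_le (by omega), show d + 1 - 1 - i = d - i by omega, Nat.sub_sub_self hi]
  ring

theorem formEval_add (d : ℕ) (F G : K[X]) (a b : R) :
    formEval d (F + G) a b = formEval d F a b + formEval d G a b := by
  simp [formEval]

theorem formEval_sub (d : ℕ) (F G : K[X]) (a b : R) :
    formEval d (F - G) a b = formEval d F a b - formEval d G a b := by
  simp [formEval]

theorem formEval_C_mul (d : ℕ) (c : K) (F : K[X]) (a b : R) :
    formEval d (C c * F) a b = algebraMap K R c * formEval d F a b := by
  simp [formEval]

theorem formEval_zero_degree (F : K[X]) (a b : R) :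
    formEval 0 F a b = algebraMap K R (F.coeff 0) := by
  simp [formEval_eq_sum]

theorem formEval_succ_of_natDegree_le {d : ℕ} {F : K[X]} (hF : F.natDegree ≤ d) (a b : R) :
    formEval (d + 1) F a b = b * formEval d F a b := by
  have := homogenize_mul F 1 hF (n := 1) (by simp)
  rw [mul_one, homogenize_one] at this
  rw [formEval, this]
  simp [formEval, mul_comm]

theorem formEval_X_sub_C_mul {d : ℕ} {F : K[X]} (hF : F.natDegree ≤ d) (r : K) (a b : R) :
    formEval (d + 1) ((X - C r) * F) a b = (a - algebraMap K R r * b) * formEval d F a b := by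
  rw [mul_comm, formEval, homogenize_mul F (X - C r) hF (n := 1) (by simp)]
  simp [formEval, mul_comm]

theorem formEval_map_algebraMap {L : Type*} [Field L] [Algebra K L] [Algebra L R]
    [IsScalarTower K L R] (d : ℕ) (F : K[X]) (a b : R) :
    formEval d (F.map (algebraMap K L)) a b = formEval d F a b := by
  simp [formEval_eq_sum, ← IsScalarTower.algebraMap_apply]

/-- The homogeneous self-map of the plane defined by a pair of forms. -/
noncomputable def pairMap (d : ℕ) (F G : K[X]) (P : R × R) : R × R :=
  (formEval d F P.1 P.2, formEval d G P.1 P.2)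

theorem map_pairMap (φ : R →ₐ[K] S) (d : ℕ) (F G : K[X]) (P : R × R) :
    Prod.map φ φ (pairMap d F G P) = pairMap d F G (Prod.map φ φ P) := by
  simp [pairMap, map_formEval]

theorem map_pairMap_iterate (φ : R →ₐ[K] S) (d : ℕ) (F G : K[X]) (m : ℕ) (P : R × R) :
    Prod.map φ φ ((pairMap d F G)^[m] P) = (pairMap d F G)^[m] (Prod.map φ φ P) :=
  (Function.Semiconj.iterate_right (f := Prod.map φ φ) (map_pairMap φ d F G) m) P

theorem pairMap_mul (d : ℕ) (F G : K[X]) (c a b : R) :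
    pairMap d F G (c * a, c * b) =
      (c ^ d * (pairMap d F G (a, b)).1, c ^ d * (pairMap d F G (a, b)).2) := by
  simp [pairMap, formEval_mul_mul]

theorem pairMap_iterate_mul (d : ℕ) (F G : K[X]) (m : ℕ) (c a b : R) :
    (pairMap d F G)^[m] (c * a, c * b) = (c ^ d ^ m * ((pairMap d F G)^[m] (a, b)).1,
      c ^ d ^ m * ((pairMap d F G)^[m] (a, b)).2) := by
  induction m generalizing c a b with
  | zero => simp
  | succ m ih =>
    rw [Function.iterate_succ_apply, pairMap_mul, ih, ← pow_mul, Function.iterate_succ_apply,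
      ← pow_succ']

end FormEval

/-- Two forms of degree `d` without a common zero over `ℂ`. -/
def NoCommonZero {K : Type*} [Field K] [Algebra K ℂ] (d : ℕ) (F G : K[X]) : Prop :=
  ∀ P : ℂ × ℂ, pairMap d F G P = 0 → P = 0

/-- The line through `P` is totally ramified for the pair `(F, G)`. -/
def TotallyRamified (d : ℕ) (F G : ℂ[X]) (P : ℂ × ℂ) : Prop :=
  ∃ l m : ℂ, (l, m) ≠ (0, 0) ∧ ∀ a b : ℂ,
    l * formEval d F a b + m * formEval d G a b = (P.2 * a - P.1 * b) ^ d

theorem exists_formEval_eq_zero {d : ℕ} (hd : 1 ≤ d) {F : ℂ[X]} (hF : F.natDegree ≤ d) :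
    ∃ P : ℂ × ℂ, P ≠ 0 ∧ formEval d F P.1 P.2 = 0 := by
  rcases hF.lt_or_eq with h | h
  · refine ⟨(1, 0), by simp, ?_⟩
    obtain ⟨d, rfl⟩ : ∃ e, d = e + 1 := ⟨d - 1, by omega⟩
    rw [formEval_succ_of_natDegree_le (by omega), zero_mul]
  · obtain ⟨r, hr⟩ := IsAlgClosed.exists_root F (by
      intro h0
      have := natDegree_eq_zero_iff_degree_le_zero.mpr h0.le
      omega)
    exact ⟨(r, 1), by simp, by rw [formEval_one_right hF]; simpa using hr⟩

theorem linear_combination_ne_zero {d : ℕ} (hd : 1 ≤ d) {F G : ℂ[X]} (hF : F.natDegree ≤ d)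
    (hG : G.natDegree ≤ d) (hnz : NoCommonZero d F G) {u v : ℂ} (huv : (u, v) ≠ 0) :
    C v * F - C u * G ≠ 0 := by
  intro h0
  have key : ∀ a b : ℂ, v * formEval d F a b = u * formEval d G a b := by
    intro a b
    have := congrArg (fun L => formEval d L a b) (sub_eq_zero.mp h0)
    simpa [formEval_C_mul] using this
  by_cases hv : v = 0
  · have hu : u ≠ 0 := fun hu => huv (by simp [hu, hv])
    obtain ⟨P, hP, hP0⟩ := exists_formEval_eq_zero hd hF
    refine hP (hnz P (Prod.ext hP0 ?_))
    have := key P.1 P.2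
    rw [hP0, mul_zero] at this
    exact (mul_eq_zero.mp this.symm).resolve_left hu
  · obtain ⟨P, hP, hP0⟩ := exists_formEval_eq_zero hd hG
    refine hP (hnz P (Prod.ext ?_ hP0))
    have := key P.1 P.2
    rw [hP0, mul_zero] at this
    exact (mul_eq_zero.mp this).resolve_left hv

/-- The linear form vanishing on the line of `γ(0)`, evaluated along the germ `γ`. -/
noncomputable def germLine (γ : ℂ[X] × ℂ[X]) : ℂ[X] :=
  C (γ.2.eval 0) * γ.1 - C (γ.1.eval 0) * γ.2

theorem natTrailingDegree_eq_zero_of_eval_ne_zero {p : ℂ[X]} (h : p.eval 0 ≠ 0) :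
    p.natTrailingDegree = 0 :=
  natTrailingDegree_eq_zero.mpr (.inr (by rwa [coeff_zero_eq_eval_zero]))

theorem natTrailingDegree_C_mul_of_ne_zero {c : ℂ} (hc : c ≠ 0) {p : ℂ[X]} (hp : p ≠ 0) :
    (C c * p).natTrailingDegree = p.natTrailingDegree := by
  rw [natTrailingDegree_mul (C_ne_zero.mpr hc) hp, natTrailingDegree_C, zero_add]

theorem exists_eq_mul_of_cross_eq_zero {s t a b : ℂ} (hst : (s, t) ≠ 0) (hab : (a, b) ≠ 0)
    (h : s * a = t * b) : ∃ c : ℂ, c ≠ 0 ∧ s = c * b ∧ t = c * a := by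
  by_cases ha : a = 0
  · subst ha
    have hb : b ≠ 0 := fun hb => hab (by simp [hb])
    have ht : t = 0 := by simpa [hb] using h.symm
    subst ht
    have hs : s ≠ 0 := fun hs => hst (by simp [hs])
    exact ⟨s / b, div_ne_zero hs hb, by field_simp, by simp⟩
  · have hs : s = t / a * b := by field_simp; exact h
    have ht : t ≠ 0 := fun ht => hst (by simp [hs, ht])
    exact ⟨t / a, div_ne_zero ht ha, hs, by field_simp⟩

theorem linear_form_germ {γ : ℂ[X] × ℂ[X]} (h0 : (γ.1.eval 0, γ.2.eval 0) ≠ 0)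
    (hγ : germLine γ ≠ 0) {s t : ℂ} (hst : (s, t) ≠ 0) :
    C s * γ.1 - C t * γ.2 ≠ 0 ∧ ((C s * γ.1 - C t * γ.2).natTrailingDegree = 0 ∨
      (C s * γ.1 - C t * γ.2).natTrailingDegree = (germLine γ).natTrailingDegree ∧
      ∃ c : ℂ, c ≠ 0 ∧ s = c * γ.2.eval 0 ∧ t = c * γ.1.eval 0) := by
  by_cases h : s * γ.1.eval 0 = t * γ.2.eval 0
  · obtain ⟨c, hc, hs, ht⟩ := exists_eq_mul_of_cross_eq_zero hst h0 h
    have key : C s * γ.1 - C t * γ.2 = C c * germLine γ := by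
      rw [germLine, hs, ht, C_mul, C_mul]; ring
    rw [key]
    exact ⟨mul_ne_zero (C_ne_zero.mpr hc) hγ,
      .inr ⟨natTrailingDegree_C_mul_of_ne_zero hc hγ, c, hc, hs, ht⟩⟩
  · have he : (C s * γ.1 - C t * γ.2).eval 0 ≠ 0 := by
      simpa using sub_ne_zero.mpr h
    exact ⟨fun h' => he (by simp [h']), .inl (natTrailingDegree_eq_zero_of_eval_ne_zero he)⟩

theorem exists_linear_factor {d : ℕ} {L : ℂ[X]} (hL : L ≠ 0) (hd : L.natDegree ≤ d + 1) :
    ∃ (s t : ℂ) (M : ℂ[X]), (s, t) ≠ 0 ∧ M ≠ 0 ∧ M.natDegree ≤ d ∧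
      (∀ a b : ℂ[X], formEval (d + 1) L a b = (C s * a - C t * b) * formEval d M a b) ∧
      ∀ a b : ℂ, formEval (d + 1) L a b = (s * a - t * b) * formEval d M a b := by
  rcases hd.lt_or_eq with h | h
  · refine ⟨0, -1, L, by simp, hL, by omega, fun a b => ?_, fun a b => ?_⟩ <;>
    · rw [formEval_succ_of_natDegree_le (by omega)]; simp
  · obtain ⟨r, hr⟩ := IsAlgClosed.exists_root L (by
      intro h0
      have := natDegree_eq_zero_iff_degree_le_zero.mpr h0.le
      omega)
    obtain ⟨M, rfl⟩ := dvd_iff_isRoot.mpr hr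
    have hM : M ≠ 0 := right_ne_zero_of_mul hL
    rw [natDegree_mul (X_sub_C_ne_zero r) hM, natDegree_X_sub_C] at h
    refine ⟨1, r, M, by simp, hM, by omega, fun a b => ?_, fun a b => ?_⟩ <;>
    · rw [formEval_X_sub_C_mul (by omega)]; simp

theorem formEval_germ {γ : ℂ[X] × ℂ[X]} (h0 : (γ.1.eval 0, γ.2.eval 0) ≠ 0)
    (hγ : germLine γ ≠ 0) (d : ℕ) : ∀ {L : ℂ[X]}, L ≠ 0 → L.natDegree ≤ d →
    formEval d L γ.1 γ.2 ≠ 0 ∧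
    (formEval d L γ.1 γ.2).natTrailingDegree ≤ d * (germLine γ).natTrailingDegree ∧
    ((formEval d L γ.1 γ.2).natTrailingDegree + (germLine γ).natTrailingDegree ≤
        d * (germLine γ).natTrailingDegree ∨
      ∃ c : ℂ, c ≠ 0 ∧ ∀ x y : ℂ,
        formEval d L x y = c * (γ.2.eval 0 * x - γ.1.eval 0 * y) ^ d) := by
  induction d with
  | zero =>
    intro L hL hd
    have hc : L.coeff 0 ≠ 0 := by
      intro hc
      rw [eq_C_of_natDegree_le_zero hd, hc, C_0] at hL
      exact hL rfl
    refine ⟨?_, ?_, .inr ⟨L.coeff 0, hc, fun x y => ?_⟩⟩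
    · rw [formEval_zero_degree]; exact C_ne_zero.mpr hc
    · rw [formEval_zero_degree, algebraMap_eq, natTrailingDegree_C]; simp
    · rw [formEval_zero_degree]; simp
  | succ d ih =>
    intro L hL hd
    obtain ⟨s, t, M, hst, hM, hMd, h1, h2⟩ := exists_linear_factor hL hd
    obtain ⟨hl0, hl⟩ := linear_form_germ h0 hγ hst
    obtain ⟨hi0, hi1, hi2⟩ := ih hM hMd
    rw [h1, natTrailingDegree_mul hl0 hi0]
    refine ⟨mul_ne_zero hl0 hi0, ?_, ?_⟩
    · rcases hl with hl | ⟨hl, -⟩ <;> rw [hl] <;> nlinarith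
    · rcases hl with hl | ⟨hl, c, hc, hs, ht⟩
      · left; rw [hl]; nlinarith
      · rcases hi2 with hi2 | ⟨c', hc', hi2⟩
        · left; rw [hl]; nlinarith
        · refine .inr ⟨c * c', mul_ne_zero hc hc', fun x y => ?_⟩
          rw [h2, hi2, hs, ht]; ring

theorem eval_zero_pairMap (d : ℕ) (F G : ℂ[X]) (γ : ℂ[X] × ℂ[X]) :
    ((pairMap d F G γ).1.eval 0, (pairMap d F G γ).2.eval 0) =
      pairMap d F G (γ.1.eval 0, γ.2.eval 0) := by
  have := map_pairMap (aeval (R := ℂ) (0 : ℂ)) d F G γ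
  simpa [Prod.map, coe_aeval_eq_eval] using this

theorem eval_zero_pairMap_iterate (d : ℕ) (F G : ℂ[X]) (m : ℕ) (γ : ℂ[X] × ℂ[X]) :
    (((pairMap d F G)^[m] γ).1.eval 0, ((pairMap d F G)^[m] γ).2.eval 0) =
      (pairMap d F G)^[m] (γ.1.eval 0, γ.2.eval 0) := by
  have := map_pairMap_iterate (aeval (R := ℂ) (0 : ℂ)) d F G m γ
  simpa [Prod.map, coe_aeval_eq_eval] using this

section Ramification
variable {d : ℕ} {F G : ℂ[X]}

theorem germLine_pairMap (hd : 1 ≤ d) (hF : F.natDegree ≤ d) (hG : G.natDegree ≤ d)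
    (hnz : NoCommonZero d F G) {γ : ℂ[X] × ℂ[X]} (h0 : (γ.1.eval 0, γ.2.eval 0) ≠ 0)
    (hγ : germLine γ ≠ 0) : germLine (pairMap d F G γ) ≠ 0 ∧
    (germLine (pairMap d F G γ)).natTrailingDegree ≤ d * (germLine γ).natTrailingDegree ∧
    ((germLine (pairMap d F G γ)).natTrailingDegree + (germLine γ).natTrailingDegree ≤
        d * (germLine γ).natTrailingDegree ∨ TotallyRamified d F G (γ.1.eval 0, γ.2.eval 0)) := by
  obtain ⟨u, hu⟩ : ∃ u, (pairMap d F G γ).1.eval 0 = u := ⟨_, rfl⟩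
  obtain ⟨v, hv⟩ : ∃ v, (pairMap d F G γ).2.eval 0 = v := ⟨_, rfl⟩
  have huv : (u, v) ≠ 0 := by
    intro h
    rw [← hu, ← hv, eval_zero_pairMap] at h
    exact h0 (hnz _ h)
  have hline : germLine (pairMap d F G γ) = formEval d (C v * F - C u * G) γ.1 γ.2 := by
    rw [germLine, hu, hv, formEval_sub, formEval_C_mul, formEval_C_mul]
    rfl
  rw [hline]
  have hdeg : (C v * F - C u * G).natDegree ≤ d :=
    (natDegree_sub_le _ _).trans (max_le ((natDegree_C_mul_le _ _).trans hF)
      ((natDegree_C_mul_le _ _).trans hG))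
  obtain ⟨h1, h2, h3⟩ := formEval_germ h0 hγ d (linear_combination_ne_zero hd hF hG hnz huv) hdeg
  refine ⟨h1, h2, h3.imp_right ?_⟩
  rintro ⟨c, hc, h⟩
  refine ⟨v / c, -u / c, ?_, fun a b => ?_⟩
  · simp only [ne_eq, Prod.mk.injEq, div_eq_zero_iff, hc, or_false, neg_eq_zero]
    rintro ⟨rfl, rfl⟩
    exact huv rfl
  · have := h a b
    rw [formEval_sub, formEval_C_mul, formEval_C_mul] at this
    simp only [Algebra.algebraMap_self, RingHom.id_apply] at this
    rw [← mul_right_inj' hc, ← this]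
    field_simp
    ring

end Ramification

/-- Two vectors of the plane span the same line. -/
def SameLine (P Q : ℂ × ℂ) : Prop := ∃ c : ℂ, c ≠ 0 ∧ P = (c * Q.1, c * Q.2)

theorem SameLine.symm {P Q : ℂ × ℂ} (h : SameLine P Q) : SameLine Q P := by
  obtain ⟨c, hc, rfl⟩ := h
  exact ⟨c⁻¹, inv_ne_zero hc, by simp [hc]⟩

theorem SameLine.trans {P Q R : ℂ × ℂ} (h : SameLine P Q) (h' : SameLine Q R) :
    SameLine P R := by
  obtain ⟨c, hc, rfl⟩ := h
  obtain ⟨c', hc', rfl⟩ := h'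
  exact ⟨c * c', mul_ne_zero hc hc', by simp [mul_assoc]⟩

theorem sameLine_of_cross_eq_zero {P Q : ℂ × ℂ} (hP : P ≠ 0) (hQ : Q ≠ 0)
    (h : P.2 * Q.1 - P.1 * Q.2 = 0) : SameLine P Q := by
  obtain ⟨c, hc, h1, h2⟩ := exists_eq_mul_of_cross_eq_zero (s := P.1) (t := P.2) (a := Q.2)
    (b := Q.1) (by simpa using hP) (fun h0 => hQ (by rw [Prod.mk_eq_zero] at h0; ext <;> simp [h0]))
    (sub_eq_zero.mp h).symm
  exact ⟨c, hc, Prod.ext h1 h2⟩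

section Ramification
variable {d : ℕ} {F G : ℂ[X]}

theorem SameLine.pairMap {P Q : ℂ × ℂ} (h : SameLine P Q) :
    SameLine (pairMap d F G P) (pairMap d F G Q) := by
  obtain ⟨c, hc, rfl⟩ := h
  exact ⟨c ^ d, pow_ne_zero d hc, pairMap_mul d F G c Q.1 Q.2⟩

theorem TotallyRamified.of_sameLine {P Q : ℂ × ℂ} (h : SameLine P Q)
    (hQ : TotallyRamified d F G Q) : TotallyRamified d F G P := by
  obtain ⟨c, hc, rfl⟩ := h
  obtain ⟨l, m, hlm, h⟩ := hQ
  refine ⟨c ^ d * l, c ^ d * m, ?_, fun a b => ?_⟩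
  · simpa [hc] using hlm
  · rw [show c * Q.2 * a - c * Q.1 * b = c * (Q.2 * a - Q.1 * b) by ring, mul_pow, ← h]
    ring

theorem coeff_eq_zero_of_pow_identity (hd : 2 ≤ d) {α β γ p q : ℂ} (hp : p ≠ 0) (hq : q ≠ 0)
    (h : ∀ z : ℂ, α * z ^ d + β + γ * (p + z * q) ^ d = 0) : γ = 0 := by
  have h1 : C α * X ^ d + C β + C γ * (C p + C q * X) ^ d = (0 : ℂ[X]) :=
    Polynomial.funext fun z => by simpa [mul_comm q] using h z
  have h2 := congrArg (fun r : ℂ[X] => (derivative r).eval 0) h1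
  have h3 : d - 1 ≠ 0 := by omega
  have h4 : (d : ℂ) ≠ 0 := Nat.cast_ne_zero.mpr (by omega)
  simpa [derivative_pow, h3, hp, hq, h4, show d ≠ 0 by omega] using h2

theorem sameLine_of_totallyRamified (hd : 2 ≤ d) {P Q R : ℂ × ℂ} (hP0 : P ≠ 0) (hQ0 : Q ≠ 0)
    (hR0 : R ≠ 0) (hP : TotallyRamified d F G P) (hQ : TotallyRamified d F G Q)
    (hR : TotallyRamified d F G R) : SameLine P Q ∨ SameLine Q R ∨ SameLine P R := by
  by_contra! hcon
  obtain ⟨hPQ, hQR, hPR⟩ := hcon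
  have hw : P.2 * Q.1 - P.1 * Q.2 ≠ 0 := fun h => hPQ (sameLine_of_cross_eq_zero hP0 hQ0 h)
  have hq : R.2 * Q.1 - R.1 * Q.2 ≠ 0 := fun h => hQR (sameLine_of_cross_eq_zero hR0 hQ0 h).symm
  have hp : R.2 * P.1 - R.1 * P.2 ≠ 0 := fun h => hPR (sameLine_of_cross_eq_zero hR0 hP0 h).symm
  obtain ⟨l₁, m₁, -, h₁⟩ := hP
  obtain ⟨l₂, m₂, hlm, h₂⟩ := hQ
  obtain ⟨l₃, m₃, -, h₃⟩ := hR
  have hdet : l₁ * m₂ - l₂ * m₁ = 0 := by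
    refine coeff_eq_zero_of_pow_identity hd hp hq
      (α := (l₂ * m₃ - l₃ * m₂) * (P.2 * Q.1 - P.1 * Q.2) ^ d)
      (β := (l₃ * m₁ - l₁ * m₃) * (Q.2 * P.1 - Q.1 * P.2) ^ d) fun z => ?_
    have e₁ := h₁ (P.1 + z * Q.1) (P.2 + z * Q.2)
    have e₂ := h₂ (P.1 + z * Q.1) (P.2 + z * Q.2)
    have e₃ := h₃ (P.1 + z * Q.1) (P.2 + z * Q.2)
    rw [show P.2 * (P.1 + z * Q.1) - P.1 * (P.2 + z * Q.2) = z * (P.2 * Q.1 - P.1 * Q.2) by ring,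
      mul_pow] at e₁
    rw [show Q.2 * (P.1 + z * Q.1) - Q.1 * (P.2 + z * Q.2) = Q.2 * P.1 - Q.1 * P.2 by ring] at e₂
    rw [show R.2 * (P.1 + z * Q.1) - R.1 * (P.2 + z * Q.2) = (R.2 * P.1 - R.1 * P.2) +
      z * (R.2 * Q.1 - R.1 * Q.2) by ring] at e₃
    rw [← e₂, ← e₃, mul_assoc, mul_comm _ (z ^ d), ← e₁]
    ring
  have e₁ := h₁ Q.1 Q.2
  have e₂ := h₂ Q.1 Q.2
  rw [show Q.2 * Q.1 - Q.1 * Q.2 = 0 by ring, zero_pow (by omega)] at e₂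
  have hw' := pow_ne_zero d hw
  apply hlm
  have hl : l₂ * (P.2 * Q.1 - P.1 * Q.2) ^ d = 0 := by
    rw [← e₁]
    linear_combination l₁ * e₂ - formEval d G Q.1 Q.2 * hdet
  have hm : m₂ * (P.2 * Q.1 - P.1 * Q.2) ^ d = 0 := by
    rw [← e₁]
    linear_combination m₁ * e₂ + formEval d F Q.1 Q.2 * hdet
  rw [mul_eq_zero, or_iff_left hw'] at hl hm
  rw [hl, hm]

theorem pairMap_iterate_ne_zero (hnz : NoCommonZero d F G) {P : ℂ × ℂ} (hP : P ≠ 0) (m : ℕ) :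
    (pairMap d F G)^[m] P ≠ 0 := by
  induction m with
  | zero => exact hP
  | succ m ih => rw [Function.iterate_succ_apply']; exact fun h => ih (hnz _ h)

theorem periodic_of_totallyRamified (hd : 2 ≤ d) (hnz : NoCommonZero d F G) {P : ℂ × ℂ}
    (hP : P ≠ 0) (h₀ : TotallyRamified d F G P) (h₁ : TotallyRamified d F G (pairMap d F G P))
    (h₂ : TotallyRamified d F G (pairMap d F G (pairMap d F G P))) (j : ℕ) :
    TotallyRamified d F G ((pairMap d F G)^[j + 1] P) ∧
    TotallyRamified d F G ((pairMap d F G)^[j + 2] P) ∧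
    SameLine ((pairMap d F G)^[j + 3] P) ((pairMap d F G)^[j + 1] P) := by
  induction j with
  | zero =>
    refine ⟨h₁, h₂, ?_⟩
    change SameLine (pairMap d F G (pairMap d F G (pairMap d F G P))) (pairMap d F G P)
    rcases sameLine_of_totallyRamified hd hP (fun h => hP (hnz _ h))
      (fun h => hP (hnz _ (hnz _ h))) h₀ h₁ h₂ with h | h | h
    · exact h.symm.pairMap.pairMap.trans h.symm.pairMap
    · exact h.symm.pairMap.trans h.symm
    · exact h.symm.pairMap
  | succ j ih =>
    obtain ⟨i₁, i₂, i₃⟩ := ih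
    refine ⟨i₂, .of_sameLine i₃ i₁, ?_⟩
    simpa only [Function.iterate_succ_apply'] using i₃.pairMap (d := d) (F := F) (G := G)

/-- If the point at infinity is totally ramified, with totally ramified image, and of period
dividing two, then the second iterate is polynomial. -/
theorem formEval_pairMap_eq_pow (hd : 2 ≤ d) {P : ℂ × ℂ} (hP : P ≠ 0)
    (hP2 : P.2 = 0) (h₀ : TotallyRamified d F G P)
    (h₁ : TotallyRamified d F G (pairMap d F G P))
    (h₂ : SameLine (pairMap d F G (pairMap d F G P)) P) :
    ∃ c : ℂ, ∀ a b : ℂ,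
      formEval d G (pairMap d F G (a, b)).1 (pairMap d F G (a, b)).2 = c * b ^ (d * d) := by
  obtain ⟨l, m, hlm, h⟩ := h₀
  obtain ⟨l', m', hlm', h'⟩ := h₁
  obtain ⟨q₁, hq₁⟩ : ∃ q, (pairMap d F G P).1 = q := ⟨_, rfl⟩
  obtain ⟨q₂, hq₂⟩ : ∃ q, (pairMap d F G P).2 = q := ⟨_, rfl⟩
  obtain ⟨c, hc, h₂⟩ := h₂
  have hP1 : P.1 ≠ 0 := fun h0 => hP (Prod.ext h0 hP2)
  have hGq : formEval d G q₁ q₂ = 0 := by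
    have := congrArg Prod.snd h₂
    simpa [pairMap, hP2, ← hq₁, ← hq₂] using this
  have hFq : formEval d F q₁ q₂ ≠ 0 := by
    have := congrArg Prod.fst h₂
    simp only [pairMap, ← hq₁, ← hq₂] at this ⊢
    rw [this]
    exact mul_ne_zero hc hP1
  have hd0 : d ≠ 0 := by omega
  have hl' : l' = 0 := by
    have := h' q₁ q₂
    rw [hGq, hq₁, hq₂, show q₂ * q₁ - q₁ * q₂ = 0 by ring, zero_pow hd0] at this
    simpa [hFq] using this
  have hm' : m' ≠ 0 := fun h0 => hlm' (by rw [hl', h0])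
  have hq : l * q₁ + m * q₂ = 0 := by
    have := h P.1 P.2
    rw [show P.2 * P.1 - P.1 * P.2 = 0 by ring, zero_pow hd0] at this
    rw [← hq₁, ← hq₂]; exact this
  obtain ⟨s, t, hs, hst⟩ : ∃ s t : ℂ, s ≠ 0 ∧ ∀ a b : ℂ,
      s * (q₂ * formEval d F a b - q₁ * formEval d G a b) = t * (-(P.1 * b)) ^ d := by
    by_cases hl : l = 0
    · have hm : m ≠ 0 := fun h0 => hlm (by rw [hl, h0])
      refine ⟨m, -q₁, hm, fun a b => ?_⟩
      have := h a b
      rw [hP2, zero_mul, zero_sub] at this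
      rw [← this]
      linear_combination formEval d F a b * hq
    · refine ⟨l, q₂, hl, fun a b => ?_⟩
      have := h a b
      rw [hP2, zero_mul, zero_sub] at this
      rw [← this]
      linear_combination -formEval d G a b * hq
  refine ⟨(t / s * (-P.1) ^ d) ^ d / m', fun a b => ?_⟩
  have e := h' (formEval d F a b) (formEval d G a b)
  rw [hl', zero_mul, zero_add, hq₁, hq₂] at e
  have e2 : q₂ * formEval d F a b - q₁ * formEval d G a b = t / s * (-P.1) ^ d * b ^ d := by
    have := hst a b
    rw [← neg_mul, mul_pow] at this
    field_simp
    linear_combination this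
  rw [e2, mul_pow, ← pow_mul] at e
  simp only [pairMap]
  rw [div_mul_eq_mul_div, eq_div_iff hm', mul_comm, e]

/-- After `3q` steps the order of contact of a transversal germ with the line at infinity is at
most `(d ^ 2 * (d - 1)) ^ q`, unless the second iterate is polynomial. -/
theorem natTrailingDegree_pairMap_iterate (hd : 2 ≤ d) (hF : F.natDegree ≤ d)
    (hG : G.natDegree ≤ d) (hnz : NoCommonZero d F G)
    (hpow : ¬ ∃ c : ℂ, ∀ a b : ℂ,
      formEval d G (pairMap d F G (a, b)).1 (pairMap d F G (a, b)).2 = c * b ^ (d * d))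
    {γ : ℂ[X] × ℂ[X]} (h0 : (γ.1.eval 0, γ.2.eval 0) ≠ 0) (hγ : germLine γ ≠ 0)
    (hγ1 : (germLine γ).natTrailingDegree ≤ 1) (q : ℕ) :
    ((pairMap d F G)^[3 * q] γ).2 ≠ 0 ∧
    ((pairMap d F G)^[3 * q] γ).2.natTrailingDegree ≤ (d ^ 2 * (d - 1)) ^ q := by
  set Φ := pairMap (R := ℂ[X]) d F G with hΦ
  set P : ℂ × ℂ := (γ.1.eval 0, γ.2.eval 0) with hPdef
  have hval (j : ℕ) : ((Φ^[j] γ).1.eval 0, (Φ^[j] γ).2.eval 0) = (pairMap d F G)^[j] P :=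
    eval_zero_pairMap_iterate d F G j γ
  have hval2 (j : ℕ) : (Φ^[j] γ).2.eval 0 = ((pairMap d F G)^[j] P).2 := by rw [← hval]
  have hne (j : ℕ) : (pairMap d F G)^[j] P ≠ 0 := pairMap_iterate_ne_zero hnz h0 j
  by_cases hinf : ((pairMap d F G)^[3 * q] P).2 = 0
  swap
  · have hev : (Φ^[3 * q] γ).2.eval 0 ≠ 0 := by rwa [hval2]
    exact ⟨fun h => hev (by rw [h, eval_zero]),
      (natTrailingDegree_eq_zero_of_eval_ne_zero hev).le.trans (Nat.zero_le _)⟩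
  have hgl (j : ℕ) : germLine (Φ^[j] γ) ≠ 0 := by
    induction j with
    | zero => exact hγ
    | succ j ih =>
      rw [Function.iterate_succ_apply']
      exact (germLine_pairMap (by omega) hF hG hnz (by rw [hval]; exact hne j) ih).1
  set ρ : ℕ → ℕ := fun j => (germLine (Φ^[j] γ)).natTrailingDegree with hρ
  have hstep (j : ℕ) : ρ (j + 1) ≤ d * ρ j ∧
      (ρ (j + 1) + ρ j ≤ d * ρ j ∨ TotallyRamified d F G ((pairMap d F G)^[j] P)) := by
    have := (germLine_pairMap (by omega) hF hG hnz (by rw [hval]; exact hne j) (hgl j)).2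
    rw [hval] at this
    simpa only [hρ, Function.iterate_succ_apply'] using this
  have hno (i : ℕ) (hi : i + 3 ≤ 3 * q) : ¬ (TotallyRamified d F G ((pairMap d F G)^[i] P) ∧
      TotallyRamified d F G ((pairMap d F G)^[i + 1] P) ∧
      TotallyRamified d F G ((pairMap d F G)^[i + 2] P)) := by
    rintro ⟨t₀, t₁, t₂⟩
    rw [Function.iterate_succ_apply'] at t₁
    rw [Function.iterate_succ_apply', Function.iterate_succ_apply'] at t₂
    obtain ⟨e₁, e₂, e₃⟩ := periodic_of_totallyRamified hd hnz (hne i) t₀ t₁ t₂ (3 * q - i - 1)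
    simp only [← Function.iterate_add_apply] at e₁ e₂ e₃
    rw [show 3 * q - i - 1 + 1 + i = 3 * q by omega] at e₁ e₃
    rw [show 3 * q - i - 1 + 2 + i = 3 * q + 1 by omega, Function.iterate_succ_apply'] at e₂
    rw [show 3 * q - i - 1 + 3 + i = 3 * q + 2 by omega, Function.iterate_succ_apply',
      Function.iterate_succ_apply'] at e₃
    exact hpow (formEval_pairMap_eq_pow hd (hne _) hinf e₁ e₂ e₃)
  have hthree (i : ℕ) (hi : i + 3 ≤ 3 * q) : ρ (i + 3) ≤ d ^ 2 * (d - 1) * ρ i := by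
    obtain ⟨e, rfl⟩ : ∃ e, d = e + 1 := ⟨d - 1, by omega⟩
    obtain ⟨a₀, b₀⟩ := hstep i
    obtain ⟨a₁, b₁⟩ := hstep (i + 1)
    obtain ⟨a₂, b₂⟩ := hstep (i + 2)
    have := hno i hi
    rw [Nat.add_sub_cancel]
    have key : ∀ j, ρ (j + 1) + ρ j ≤ (e + 1) * ρ j → ρ (j + 1) ≤ e * ρ j := by
      intro j hj; nlinarith
    have hmono : ∀ k x y : ℕ, x ≤ y → k * x ≤ k * y := fun k x y h => Nat.mul_le_mul_left k h
    rcases b₀ with b₀ | b₀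
    · have c := key _ b₀
      calc ρ (i + 3) ≤ (e + 1) * ((e + 1) * (e * ρ i)) :=
            a₂.trans (hmono _ _ _ (a₁.trans (hmono _ _ _ c)))
        _ = _ := by ring
    rcases b₁ with b₁ | b₁
    · have c := key _ b₁
      calc ρ (i + 3) ≤ (e + 1) * (e * ((e + 1) * ρ i)) :=
            a₂.trans (hmono _ _ _ (c.trans (hmono _ _ _ a₀)))
        _ = _ := by ring
    rcases b₂ with b₂ | b₂
    · have c := key _ b₂
      calc ρ (i + 3) ≤ e * ((e + 1) * ((e + 1) * ρ i)) :=
            c.trans (hmono _ _ _ (a₁.trans (hmono _ _ _ a₀)))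
        _ = _ := by ring
    exact absurd ⟨b₀, b₁, b₂⟩ this
  have hbound (k : ℕ) (hk : k ≤ q) : ρ (3 * k) ≤ (d ^ 2 * (d - 1)) ^ k := by
    induction k with
    | zero => simpa [hρ] using hγ1
    | succ k ih =>
      rw [pow_succ', show 3 * (k + 1) = 3 * k + 3 by ring]
      exact (hthree _ (by omega)).trans (Nat.mul_le_mul_left _ (ih (by omega)))
  have hu : (Φ^[3 * q] γ).1.eval 0 ≠ 0 := by
    intro hu
    apply hne (3 * q)
    rw [← hval, hu, hval2, hinf]
    rfl
  have hline : germLine (Φ^[3 * q] γ) = C (-(Φ^[3 * q] γ).1.eval 0) * (Φ^[3 * q] γ).2 := by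
    rw [germLine, hval2, hinf]
    simp
  have hv : (Φ^[3 * q] γ).2 ≠ 0 := by
    intro hv
    apply hgl (3 * q)
    rw [hline, hv, mul_zero]
  refine ⟨hv, ?_⟩
  have := hbound q le_rfl
  simp only [hρ] at this
  rwa [hline, natTrailingDegree_C_mul_of_ne_zero (neg_ne_zero.mpr hu) hv] at this

end Ramification

theorem exists_nhds_le_norm_of_ne_zero {f : ℝ → ℂ} (hf : Continuous f) {t : ℝ} (ht : f t ≠ 0) :
    ∃ c : ℝ, 0 < c ∧ ∀ᶠ x in nhds t, c ≤ ‖f x‖ := by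
  refine ⟨‖f t‖ / 2, half_pos (norm_pos_iff.mpr ht), ?_⟩
  have := (hf.norm.tendsto t).eventually (lt_mem_nhds (half_lt_self (norm_pos_iff.mpr ht)))
  filter_upwards [this] with x hx using hx.le

theorem continuous_eval_ofReal (p : ℂ[X]) : Continuous fun x : ℝ => p.eval (x : ℂ) :=
  p.continuous.comp Complex.continuous_ofReal

/-- An algebraic number is a simple root of its minimal polynomial. -/
theorem exists_minpoly_map_eq_mul {β : ℂ} (hβ : IsAlgebraic ℚ β) :
    ∃ r : ℂ[X], (minpoly ℚ β).map (algebraMap ℚ ℂ) = (X - C β) * r ∧ r.eval β ≠ 0 := by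
  have hroot : ((minpoly ℚ β).map (algebraMap ℚ ℂ)).IsRoot β := by
    rw [IsRoot, eval_map_algebraMap, minpoly.aeval]
  obtain ⟨r, hr⟩ := dvd_iff_isRoot.mpr hroot
  refine ⟨r, hr, fun h0 => ?_⟩
  have hsep := (minpoly.irreducible hβ.isIntegral).separable
  apply hsep.aeval_derivative_ne_zero (minpoly.aeval ℚ β)
  rw [← eval_map_algebraMap, ← derivative_map, hr]
  simp [derivative_mul, h0]

theorem thue_siegel_uniform {β : ℂ} (hβ : IsAlgebraic ℚ β) {k e s N : ℕ} (hk : k ≤ e)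
    (hN : k * (minpoly ℚ β).natDegree ≤ N) :
    ∃ Q₀ : ℕ, ∀ x : ℚ, Q₀ ≤ x.den → (x : ℂ) ≠ β →
      (x.den : ℝ) ^ (-(e * (s + 1) + N / (s + 1) : ℝ)) ≤ ‖(x : ℂ) - β‖ ^ k := by
  set D := (minpoly ℚ β).natDegree with hD
  have hD0 : 0 < D := minpoly.natDegree_pos hβ.isIntegral
  have hke : (k : ℝ) ≤ e := by exact_mod_cast hk
  have hkN : (k : ℝ) * D ≤ N := by exact_mod_cast hN
  obtain ⟨κ, hκ, Q₀, h⟩ : ∃ κ : ℝ, k * κ ≤ e * (s + 1) + N / (s + 1) ∧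
      ∃ Q₀ : ℕ, ∀ (a : ℤ) (b : ℕ), Q₀ ≤ b → (a / b : ℂ) ≠ β →
        (b : ℝ) ^ (-κ) ≤ ‖(a / b : ℂ) - β‖ := by
    by_cases hs : s < D
    · refine ⟨s + D / (s + 1) + 1, ?_, thue_siegel hβ hs (by rw [← hD]; linarith)⟩
      have h1 : (k : ℝ) * D / (s + 1) ≤ N / (s + 1) := by gcongr
      have h2 : (k : ℝ) * (s + 1) ≤ e * (s + 1) := by gcongr
      calc (k : ℝ) * (s + D / (s + 1) + 1) = k * (s + 1) + k * D / (s + 1) := by ring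
        _ ≤ _ := by linarith
    · refine ⟨D + 1, ?_, thue_siegel hβ hD0 (by rw [← hD]; simp)⟩
      have h1 : (0 : ℝ) ≤ N / (s + 1) := by positivity
      have h3 : (D : ℝ) ≤ s := by exact_mod_cast not_lt.mp hs
      have h2 : (k : ℝ) * (D + 1) ≤ e * (s + 1) := by gcongr
      linarith
  refine ⟨Q₀, fun x hx hxβ => ?_⟩
  have hden : (1 : ℝ) ≤ x.den := by exact_mod_cast x.pos
  have hxc : (x : ℂ) = (x.num : ℂ) / (x.den : ℂ) := Rat.cast_def x
  have := h x.num x.den hx (by rwa [← hxc])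
  rw [← hxc] at this
  calc (x.den : ℝ) ^ (-(e * (s + 1) + N / (s + 1) : ℝ)) ≤ (x.den : ℝ) ^ (-κ * k) :=
        Real.rpow_le_rpow_of_exponent_le hden (by linarith)
    _ = ((x.den : ℝ) ^ (-κ)) ^ k := Real.rpow_mul_natCast (by linarith) _ _
    _ ≤ _ := by gcongr

/-- A polynomial whose real roots have small multiplicity is not too small at rational points
close to a given real number. -/
theorem exists_lower_bound_near {V : ℚ[X]} (hV : V ≠ 0) {N e : ℕ} (s : ℕ)
    (hN : V.natDegree ≤ N) (t : ℝ)
    (hmult : (V.map (algebraMap ℚ ℂ)).rootMultiplicity (t : ℂ) ≤ e) :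
    ∃ c : ℝ, 0 < c ∧ ∃ Q₀ : ℕ, ∃ S ∈ nhds t, ∀ x : ℚ, (x : ℝ) ∈ S → Q₀ ≤ x.den → V.eval x ≠ 0 →
      c * (x.den : ℝ) ^ (-(e * (s + 1) + N / (s + 1) : ℝ)) ≤ |((V.eval x : ℚ) : ℝ)| := by
  have hinj : Function.Injective (algebraMap ℚ ℂ) := (algebraMap ℚ ℂ).injective
  have hVmap : V.map (algebraMap ℚ ℂ) ≠ 0 := (Polynomial.map_ne_zero_iff hinj).mpr hV
  have hnorm (x : ℚ) : ‖(V.map (algebraMap ℚ ℂ)).eval ((x : ℝ) : ℂ)‖ = |((V.eval x : ℚ) : ℝ)| := by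
    have : ((x : ℝ) : ℂ) = algebraMap ℚ ℂ x := by simp
    rw [this, eval_map_algebraMap, aeval_algebraMap_apply_eq_algebraMap_eval]
    simp
  by_cases hroot : (V.map (algebraMap ℚ ℂ)).eval (t : ℂ) = 0
  swap
  · obtain ⟨c, hc, hS⟩ := exists_nhds_le_norm_of_ne_zero (continuous_eval_ofReal _) hroot
    refine ⟨c, hc, 0, _, hS, fun x hx _ _ => ?_⟩
    have hden : (1 : ℝ) ≤ x.den := by exact_mod_cast x.pos
    rw [← hnorm]
    refine le_trans ?_ hx
    refine mul_le_of_le_one_right hc.le (Real.rpow_le_one_of_one_le_of_nonpos hden ?_)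
    rw [neg_nonpos]; positivity
  · have hβ : IsAlgebraic ℚ (t : ℂ) := ⟨V, hV, by rw [← eval_map_algebraMap]; exact hroot⟩
    set p := minpoly ℚ (t : ℂ) with hp
    have hpm : p.Monic := minpoly.monic hβ.isIntegral
    have hpd : 0 < p.natDegree := minpoly.natDegree_pos hβ.isIntegral
    obtain ⟨g, hg, hpg⟩ := (finiteMultiplicity_of_degree_pos_of_monic
      (natDegree_pos_iff_degree_pos.mp hpd) hpm hV).exists_eq_pow_mul_and_not_dvd
    set k := multiplicity p V
    have hg0 : g ≠ 0 := by rintro rfl; exact hV (by rw [hg, mul_zero])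
    have hgβ : (g.map (algebraMap ℚ ℂ)).eval (t : ℂ) ≠ 0 := by
      rw [eval_map_algebraMap]
      exact fun h => hpg (minpoly.dvd ℚ _ h)
    obtain ⟨r, hr, hrβ⟩ := exists_minpoly_map_eq_mul hβ
    have hVf : V.map (algebraMap ℚ ℂ) = (X - C (t : ℂ)) ^ k * (r ^ k * g.map (algebraMap ℚ ℂ)) := by
      rw [hg, Polynomial.map_mul, Polynomial.map_pow, hr, mul_pow, mul_assoc]
    have hk : k ≤ e := by
      refine le_trans ?_ hmult
      rw [le_rootMultiplicity_iff hVmap]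
      exact ⟨_, hVf⟩
    have hkN : k * p.natDegree ≤ N := by
      refine le_trans ?_ hN
      rw [hg, natDegree_mul (pow_ne_zero k hpm.ne_zero) hg0, natDegree_pow]
      exact Nat.le_add_right _ _
    obtain ⟨c, hc, hS⟩ := exists_nhds_le_norm_of_ne_zero (t := t)
      (continuous_eval_ofReal (r ^ k * g.map (algebraMap ℚ ℂ)))
      (by rw [eval_mul, eval_pow]; exact mul_ne_zero (pow_ne_zero k hrβ) hgβ)
    obtain ⟨Q₀, hQ⟩ := thue_siegel_uniform (s := s) hβ hk hkN
    refine ⟨c, hc, Q₀, _, hS, fun x hx hxQ hVx => ?_⟩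
    have hxβ : (x : ℂ) ≠ (t : ℂ) := by
      intro h
      apply hVx
      have hxt : (x : ℝ) = t := by exact_mod_cast h
      have := hnorm x
      rw [hxt, hroot, norm_zero, eq_comm, abs_eq_zero] at this
      exact_mod_cast this
    rw [← hnorm, hVf, eval_mul, norm_mul, mul_comm c]
    refine mul_le_mul ?_ hx hc.le (norm_nonneg _)
    simpa using hQ x hxQ hxβ

theorem exists_lower_bound_Icc {V : ℚ[X]} (hV : V ≠ 0) {N e : ℕ} (s : ℕ)
    (hN : V.natDegree ≤ N)
    (hmult : ∀ t : ℂ, (V.map (algebraMap ℚ ℂ)).rootMultiplicity t ≤ e) (R : ℝ) :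
    ∃ c : ℝ, 0 < c ∧ ∃ Q₀ : ℕ, ∀ x : ℚ, (x : ℝ) ∈ Set.Icc (-R) R → Q₀ ≤ x.den → V.eval x ≠ 0 →
      c * (x.den : ℝ) ^ (-(e * (s + 1) + N / (s + 1) : ℝ)) ≤ |((V.eval x : ℚ) : ℝ)| := by
  refine (isCompact_Icc (a := -R) (b := R)).induction_on (p := fun S : Set ℝ => ∃ c : ℝ, 0 < c ∧
    ∃ Q₀ : ℕ, ∀ x : ℚ, (x : ℝ) ∈ S → Q₀ ≤ x.den → V.eval x ≠ 0 →
      c * (x.den : ℝ) ^ (-(e * (s + 1) + N / (s + 1) : ℝ)) ≤ |((V.eval x : ℚ) : ℝ)|)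
    ⟨1, one_pos, 0, by simp⟩ ?_ ?_ ?_
  · rintro S T hST ⟨c, hc, Q₀, h⟩
    exact ⟨c, hc, Q₀, fun x hx => h x (hST hx)⟩
  · rintro S T ⟨c, hc, Q₀, h⟩ ⟨c', hc', Q₀', h'⟩
    refine ⟨min c c', lt_min hc hc', max Q₀ Q₀', fun x hx hQ hVx => ?_⟩
    rcases hx with hx | hx
    · refine le_trans ?_ (h x hx ((le_max_left _ _).trans hQ) hVx)
      gcongr
      exact min_le_left _ _
    · refine le_trans ?_ (h' x hx ((le_max_right _ _).trans hQ) hVx)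
      gcongr
      exact min_le_right _ _
  · intro t _
    obtain ⟨c, hc, Q₀, S, hS, h⟩ := exists_lower_bound_near hV s hN t (hmult t)
    exact ⟨S, mem_nhdsWithin_of_mem_nhds hS, c, hc, Q₀, h⟩

/-- Near zero, a polynomial is bounded below by a power of the variable. -/
theorem exists_lower_bound_near_zero {V : ℚ[X]} (hV : V ≠ 0) {e : ℕ}
    (he : V.natTrailingDegree ≤ e) : ∃ c : ℝ, 0 < c ∧ ∃ r : ℝ, 0 < r ∧ ∀ y : ℚ, |(y : ℝ)| ≤ r →
      c * |(y : ℝ)| ^ e ≤ |((V.eval y : ℚ) : ℝ)| := by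
  obtain ⟨g, hg⟩ : X ^ V.natTrailingDegree ∣ V :=
    X_pow_dvd_iff.mpr fun i hi => coeff_eq_zero_of_lt_natTrailingDegree hi
  have hg0 : (g.eval 0 : ℚ) ≠ 0 := by
    rw [← coeff_zero_eq_eval_zero]
    have : V.coeff V.natTrailingDegree ≠ 0 := by
      rw [← trailingCoeff]; exact trailingCoeff_nonzero_iff_nonzero.mpr hV
    intro h
    apply this
    clear this
    generalize V.natTrailingDegree = n at hg ⊢
    rw [hg, coeff_X_pow_mul']
    simpa using h
  have hcont : Continuous fun y : ℝ => |(g.map (algebraMap ℚ ℝ)).eval y| :=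
    (Polynomial.continuous _).abs
  have heval (y : ℚ) : (g.map (algebraMap ℚ ℝ)).eval (y : ℝ) = ((g.eval y : ℚ) : ℝ) := by
    have : (y : ℝ) = algebraMap ℚ ℝ y := by simp
    rw [this, eval_map_algebraMap, aeval_algebraMap_apply_eq_algebraMap_eval]
    simp
  have hpos : 0 < |(g.map (algebraMap ℚ ℝ)).eval 0| := by
    have := heval 0
    rw [Rat.cast_zero] at this
    rw [this, abs_pos]
    exact_mod_cast hg0
  obtain ⟨r, hr, hball⟩ := Metric.eventually_nhds_iff.mp
    ((hcont.tendsto 0).eventually (lt_mem_nhds (half_lt_self hpos)))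
  refine ⟨|(g.map (algebraMap ℚ ℝ)).eval 0| / 2, half_pos hpos, min 1 (r / 2), by positivity,
    fun y hy => ?_⟩
  have h1 := hball (y := (y : ℝ)) (by
    rw [Real.dist_eq, sub_zero]
    exact lt_of_le_of_lt (hy.trans (min_le_right _ _)) (half_lt_self hr))
  rw [heval] at h1
  conv_rhs => rw [hg]
  rw [eval_mul, eval_pow, eval_X, Rat.cast_mul, Rat.cast_pow, abs_mul, abs_pow, mul_comm]
  refine mul_le_mul ?_ h1.le (by positivity) (by positivity)
  exact pow_le_pow_of_le_one (abs_nonneg _) (hy.trans (min_le_left _ _)) he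

section RationalPair
variable {d : ℕ} {F G : ℚ[X]}

theorem pairMap_map_algebraMap {R : Type*} [CommRing R] [Algebra ℚ R] [Algebra ℂ R]
    [IsScalarTower ℚ ℂ R] (d : ℕ) (F G : ℚ[X]) :
    pairMap (R := R) d (F.map (algebraMap ℚ ℂ)) (G.map (algebraMap ℚ ℂ)) = pairMap d F G := by
  funext P
  simp [pairMap, formEval_map_algebraMap]

/-- The second iterate of the pair does not have a pure power of `Y` as its second component. -/
def NotPurePower {K : Type*} [Field K] [Algebra K ℂ] (d : ℕ) (F G : K[X]) : Prop :=
  ¬ ∃ c : ℂ, ∀ a b : ℂ,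
    formEval d G (pairMap d F G (a, b)).1 (pairMap d F G (a, b)).2 = c * b ^ (d * d)

theorem natTrailingDegree_pairMap_iterate_rat (hd : 2 ≤ d) (hF : F.natDegree ≤ d)
    (hG : G.natDegree ≤ d) (hnz : NoCommonZero d F G) (hpow : NotPurePower d F G)
    {γ : ℂ[X] × ℂ[X]} (h0 : (γ.1.eval 0, γ.2.eval 0) ≠ 0) (hγ : germLine γ ≠ 0)
    (hγ1 : (germLine γ).natTrailingDegree ≤ 1) (q : ℕ) :
    ((pairMap d F G)^[3 * q] γ).2 ≠ 0 ∧
    ((pairMap d F G)^[3 * q] γ).2.natTrailingDegree ≤ (d ^ 2 * (d - 1)) ^ q := by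
  have := natTrailingDegree_pairMap_iterate (F := F.map (algebraMap ℚ ℂ))
    (G := G.map (algebraMap ℚ ℂ)) hd (natDegree_map_le.trans hF) (natDegree_map_le.trans hG)
    (by rw [NoCommonZero, pairMap_map_algebraMap]; exact hnz)
    (by simp only [pairMap_map_algebraMap, formEval_map_algebraMap]; exact hpow) h0 hγ hγ1 q
  rwa [pairMap_map_algebraMap] at this

theorem natDegree_formEval_le {m : ℕ} {F U V : ℚ[X]} (hU : U.natDegree ≤ m)
    (hV : V.natDegree ≤ m) : (formEval d F U V).natDegree ≤ d * m := by
  rw [formEval_eq_sum]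
  refine natDegree_sum_le_of_forall_le _ _ fun i hi => ?_
  rw [Finset.mem_range] at hi
  rw [algebraMap_eq, mul_assoc]
  refine (natDegree_C_mul_le _ _).trans (natDegree_mul_le.trans ?_)
  calc _ ≤ i * m + (d - i) * m := add_le_add (natDegree_pow_le_of_le i hU)
        (natDegree_pow_le_of_le (d - i) hV)
    _ = d * m := by rw [← add_mul]; congr 1; omega

theorem natDegree_pairMap_iterate_le (m : ℕ) :
    ((pairMap d F G)^[m] ((X : ℚ[X]), (1 : ℚ[X]))).1.natDegree ≤ d ^ m ∧
    ((pairMap d F G)^[m] ((X : ℚ[X]), (1 : ℚ[X]))).2.natDegree ≤ d ^ m := by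
  induction m with
  | zero => simp
  | succ m ih =>
    rw [Function.iterate_succ_apply', pow_succ']
    exact ⟨natDegree_formEval_le ih.1 ih.2, natDegree_formEval_le ih.1 ih.2⟩

theorem map_pairMap_iterate_germ (m : ℕ) (U V : ℚ[X]) :
    ((pairMap d F G)^[m] (U, V)).2.map (algebraMap ℚ ℂ) =
      ((pairMap d F G)^[m] (U.map (algebraMap ℚ ℂ), V.map (algebraMap ℚ ℂ))).2 := by
  have := congrArg Prod.snd
    (map_pairMap_iterate (mapAlgHom (Algebra.ofId ℚ ℂ)) d F G m (U, V))
  simpa using this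

theorem rootMultiplicity_pairMap_iterate (hd : 2 ≤ d) (hF : F.natDegree ≤ d)
    (hG : G.natDegree ≤ d) (hnz : NoCommonZero d F G) (hpow : NotPurePower d F G) (q : ℕ) :
    ((pairMap d F G)^[3 * q] ((X : ℚ[X]), (1 : ℚ[X]))).2 ≠ 0 ∧
    ∀ t : ℂ, (((pairMap d F G)^[3 * q] ((X : ℚ[X]), (1 : ℚ[X]))).2.map
      (algebraMap ℚ ℂ)).rootMultiplicity t ≤ (d ^ 2 * (d - 1)) ^ q := by
  have key (t : ℂ) : (((pairMap d F G)^[3 * q] ((X : ℚ[X]), (1 : ℚ[X]))).2.map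
      (algebraMap ℚ ℂ)).comp (X + C t) ≠ 0 ∧ (((pairMap d F G)^[3 * q] ((X : ℚ[X]),
      (1 : ℚ[X]))).2.map (algebraMap ℚ ℂ)).rootMultiplicity t ≤ (d ^ 2 * (d - 1)) ^ q := by
    have hline : germLine (X + C t, 1) = X := by simp [germLine]
    have hcomp : (((pairMap d F G)^[3 * q] ((X : ℚ[X]), (1 : ℚ[X]))).2.map
        (algebraMap ℚ ℂ)).comp (X + C t) = ((pairMap d F G)^[3 * q] (X + C t, (1 : ℂ[X]))).2 := by
      rw [map_pairMap_iterate_germ, Polynomial.map_X, Polynomial.map_one]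
      have := congrArg Prod.snd (map_pairMap_iterate
        ((aeval (R := ℂ) (X + C t : ℂ[X])).restrictScalars ℚ) d F G (3 * q) (X, 1))
      simpa [comp_eq_aeval] using this
    rw [rootMultiplicity_eq_natTrailingDegree, hcomp]
    exact natTrailingDegree_pairMap_iterate_rat hd hF hG hnz hpow (by simp)
      (by rw [hline]; exact X_ne_zero) (by rw [hline, natTrailingDegree_X]) q
  refine ⟨fun h => (key 0).1 ?_, fun t => (key t).2⟩
  rw [h, Polynomial.map_zero, zero_comp]

theorem natTrailingDegree_pairMap_iterate_infty (hd : 2 ≤ d) (hF : F.natDegree ≤ d)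
    (hG : G.natDegree ≤ d) (hnz : NoCommonZero d F G) (hpow : NotPurePower d F G) (q : ℕ) :
    ((pairMap d F G)^[3 * q] ((1 : ℚ[X]), (X : ℚ[X]))).2 ≠ 0 ∧
    ((pairMap d F G)^[3 * q] ((1 : ℚ[X]), (X : ℚ[X]))).2.natTrailingDegree ≤
      (d ^ 2 * (d - 1)) ^ q := by
  have hline : germLine ((1 : ℂ[X]), X) = -X := by simp [germLine]
  have key := natTrailingDegree_pairMap_iterate_rat hd hF hG hnz hpow (γ := ((1 : ℂ[X]), X))
    (by simp) (by rw [hline]; exact neg_ne_zero.mpr X_ne_zero)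
    (by rw [hline, natTrailingDegree_neg, natTrailingDegree_X]) q
  have hmap := map_pairMap_iterate_germ (d := d) (F := F) (G := G) (3 * q) 1 X
  rw [Polynomial.map_X, Polynomial.map_one] at hmap
  rw [← hmap] at key
  refine ⟨fun h => key.1 (by rw [h, Polynomial.map_zero]), ?_⟩
  rw [← rootMultiplicity_eq_natTrailingDegree',
    eq_rootMultiplicity_map (algebraMap ℚ ℂ).injective, map_zero,
    rootMultiplicity_eq_natTrailingDegree']
  exact key.2

theorem eval_pairMap_iterate (m : ℕ) (U V : ℚ[X]) (x : ℚ) :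
    (((pairMap d F G)^[m] (U, V)).1.eval x, ((pairMap d F G)^[m] (U, V)).2.eval x) =
      (pairMap d F G)^[m] (U.eval x, V.eval x) := by
  have := map_pairMap_iterate (aeval (R := ℚ) x) d F G m (U, V)
  simpa [Prod.map, coe_aeval_eq_eval] using this

theorem pairMap_iterate_eq_scaled (m : ℕ) {x : ℚ} (hx : x ≠ 0) :
    (pairMap d F G)^[m] (x, 1) = (x ^ d ^ m * ((pairMap d F G)^[m] (1, x⁻¹)).1,
      x ^ d ^ m * ((pairMap d F G)^[m] (1, x⁻¹)).2) := by
  rw [← pairMap_iterate_mul, mul_one, mul_inv_cancel₀ hx]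

theorem exists_upper_bound_Icc (U : ℚ[X]) (R : ℝ) :
    ∃ M : ℝ, 0 < M ∧ ∀ x : ℚ, |(x : ℝ)| ≤ R → |((U.eval x : ℚ) : ℝ)| ≤ M := by
  obtain ⟨M, hM⟩ := (isCompact_Icc (a := -R) (b := R)).exists_bound_of_continuousOn
    (U.map (algebraMap ℚ ℝ)).continuous.continuousOn
  refine ⟨max M 1, by positivity, fun x hx => ?_⟩
  have h1 := hM x (abs_le.mp hx)
  have : (x : ℝ) = algebraMap ℚ ℝ x := by simp
  rw [this, eval_map_algebraMap, aeval_algebraMap_apply_eq_algebraMap_eval, Real.norm_eq_abs,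
    eq_ratCast] at h1
  exact le_max_of_le_left h1

/-- A bound for the iterates of a rational map at rational points of large height. -/
theorem exists_iterate_bound (hd : 2 ≤ d) (hF : F.natDegree ≤ d) (hG : G.natDegree ≤ d)
    (hnz : NoCommonZero d F G) (hpow : NotPurePower d F G) (q s : ℕ) :
    ∃ K : ℝ, 0 < K ∧ ∃ H₀ : ℝ, ∀ x : ℚ, H₀ ≤ Height.mulHeight₁ x →
      ((pairMap d F G)^[3 * q] (x, 1)).2 ≠ 0 →
      |(((pairMap d F G)^[3 * q] (x, 1)).1 : ℝ)| ≤ K * Height.mulHeight₁ x ^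
        (((d ^ 2 * (d - 1)) ^ q : ℕ) * (s + 1) + (d ^ (3 * q) : ℕ) / (s + 1) : ℝ) *
          |(((pairMap d F G)^[3 * q] (x, 1)).2 : ℝ)| := by
  set e := (d ^ 2 * (d - 1)) ^ q with he
  set N := d ^ (3 * q) with hN
  set ω : ℝ := e * (s + 1) + N / (s + 1) with hω
  have hω0 : 0 ≤ ω := by positivity
  have heω : (e : ℝ) ≤ ω := by
    have h1 : (0 : ℝ) ≤ N / (s + 1) := by positivity
    have h2 : (0 : ℝ) ≤ e * s := by positivity
    rw [hω]; linarith
  obtain ⟨hV, hVm⟩ := rootMultiplicity_pairMap_iterate hd hF hG hnz hpow q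
  obtain ⟨hW, hWm⟩ := natTrailingDegree_pairMap_iterate_infty hd hF hG hnz hpow q
  obtain ⟨c₁, hc₁, r, hr, hinf⟩ := exists_lower_bound_near_zero hW hWm
  obtain ⟨c₂, hc₂, Q₀, hfin⟩ := exists_lower_bound_Icc hV s
    (natDegree_pairMap_iterate_le (3 * q)).2 hVm r⁻¹
  obtain ⟨M₁, hM₁, hU₁⟩ := exists_upper_bound_Icc
    ((pairMap d F G)^[3 * q] ((1 : ℚ[X]), (X : ℚ[X]))).1 r
  obtain ⟨M₂, hM₂, hU₂⟩ := exists_upper_bound_Icc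
    ((pairMap d F G)^[3 * q] ((X : ℚ[X]), (1 : ℚ[X]))).1 r⁻¹
  refine ⟨max (M₁ / c₁) (M₂ / c₂), by positivity, max 1 (max Q₀ (Q₀ * r⁻¹ + 1)),
    fun x hx hx0 => ?_⟩
  have hH : Height.mulHeight₁ x = max (|(x.num : ℝ)|) x.den := by
    rw [Rat.mulHeight₁_eq_max]; push_cast; simp
  set H := Height.mulHeight₁ x
  have hH1 : 1 ≤ H := (le_max_left _ _).trans hx
  have hden : (1 : ℝ) ≤ x.den := by exact_mod_cast x.pos
  have hxabs : |(x : ℝ)| * x.den = |(x.num : ℝ)| := by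
    rw [← Rat.cast_natCast, ← Rat.cast_intCast, ← Rat.cast_abs, ← Rat.cast_abs,
      ← Rat.cast_mul]
    congr 1
    rw [← Nat.abs_cast x.den, ← abs_mul, Rat.mul_den_eq_num]
  have hev₂ := eval_pairMap_iterate (d := d) (F := F) (G := G) (3 * q) X 1 x
  rw [eval_X, eval_one] at hev₂
  have hK₁ : M₁ ≤ max (M₁ / c₁) (M₂ / c₂) * c₁ := by
    rw [← div_le_iff₀ hc₁]; exact le_max_left _ _
  have hK₂ : M₂ ≤ max (M₁ / c₁) (M₂ / c₂) * c₂ := by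
    rw [← div_le_iff₀ hc₂]; exact le_max_right _ _
  have hKpos : 0 < max (M₁ / c₁) (M₂ / c₂) := by positivity
  set K := max (M₁ / c₁) (M₂ / c₂)
  by_cases hxr : |(x : ℝ)| ≤ r⁻¹
  · rw [← hev₂] at hx0 ⊢
    have hQ : Q₀ ≤ x.den := by
      by_contra! hlt
      have hlt : (x.den : ℝ) < Q₀ := by exact_mod_cast hlt
      have h1 : |(x.num : ℝ)| ≤ r⁻¹ * Q₀ := by
        rw [← hxabs]; gcongr
      have h2 : H < max (Q₀ : ℝ) (Q₀ * r⁻¹ + 1) := by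
        rw [hH]
        exact max_lt (lt_max_of_lt_right (by linarith)) (lt_max_of_lt_left hlt)
      exact absurd ((le_max_right _ _).trans hx) (not_le.mpr h2)
    have hlow := hfin x (abs_le.mp hxr) hQ hx0
    have hpow2 : H ^ (-ω) ≤ (x.den : ℝ) ^ (-ω) :=
      Real.rpow_le_rpow_of_nonpos (by linarith) (by rw [hH]; exact le_max_right _ _)
        (by linarith)
    have hone : H ^ ω * H ^ (-ω) = 1 := by
      rw [← Real.rpow_add (by linarith), add_neg_cancel, Real.rpow_zero]
    calc _ ≤ M₂ := hU₂ x hxr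
      _ ≤ K * c₂ * (H ^ ω * H ^ (-ω)) := by rw [hone, mul_one]; exact hK₂
      _ = K * H ^ ω * (c₂ * H ^ (-ω)) := by ring
      _ ≤ K * H ^ ω * (c₂ * (x.den : ℝ) ^ (-ω)) := by gcongr
      _ ≤ _ := by gcongr
  · push Not at hxr
    have hx1 : 0 < |(x : ℝ)| := (inv_pos.mpr hr).trans hxr
    have hxne : x ≠ 0 := by
      rintro rfl; simp at hx1
    have hy : |((x⁻¹ : ℚ) : ℝ)| ≤ r := by
      rw [Rat.cast_inv, abs_inv]
      exact inv_le_of_inv_le₀ hr hxr.le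
    have hev₁ := eval_pairMap_iterate (d := d) (F := F) (G := G) (3 * q) 1 X x⁻¹
    rw [eval_X, eval_one] at hev₁
    have hxH : |(x : ℝ)| ≤ H := by
      rw [hH]
      refine le_max_of_le_left ?_
      rw [← hxabs]
      exact le_mul_of_one_le_right (abs_nonneg _) hden
    have hyH : H⁻¹ ≤ |((x⁻¹ : ℚ) : ℝ)| := by
      rw [Rat.cast_inv, abs_inv]
      gcongr
    have hlow := hinf x⁻¹ hy
    have hup := hU₁ x⁻¹ hy
    rw [pairMap_iterate_eq_scaled _ hxne, ← hev₁]
    dsimp only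
    rw [Rat.cast_mul, Rat.cast_mul, abs_mul, abs_mul]
    have hpe : H ^ ω * (H⁻¹) ^ e ≥ 1 := by
      rw [ge_iff_le, inv_pow, ← Real.rpow_natCast, ← Real.rpow_neg (by linarith),
        ← Real.rpow_add (by linarith)]
      exact Real.one_le_rpow hH1 (by linarith)
    calc _ ≤ |((x ^ N : ℚ) : ℝ)| * (K * c₁ * 1) := by
          rw [mul_one]; gcongr; exact hup.trans hK₁
      _ ≤ |((x ^ N : ℚ) : ℝ)| * (K * c₁ * (H ^ ω * (H⁻¹) ^ e)) := by gcongr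
      _ = |((x ^ N : ℚ) : ℝ)| * (K * H ^ ω * (c₁ * (H⁻¹) ^ e)) := by ring
      _ ≤ |((x ^ N : ℚ) : ℝ)| * (K * H ^ ω * (c₁ * |((x⁻¹ : ℚ) : ℝ)| ^ e)) := by gcongr
      _ ≤ |((x ^ N : ℚ) : ℝ)| * (K * H ^ ω *
            |((((pairMap d F G)^[3 * q] ((1 : ℚ[X]), (X : ℚ[X]))).2.eval x⁻¹ : ℚ) : ℝ)|) := by
          gcongr
      _ = _ := by ring

end RationalPair

theorem formEval_mul {K R : Type*} [Field K] [CommRing R] [Algebra K R] {n d : ℕ} {A F : K[X]}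
    (hA : A.natDegree ≤ n) (hF : F.natDegree ≤ d) (a b : R) :
    formEval (n + d) (A * F) a b = formEval n A a b * formEval d F a b := by
  rw [formEval, homogenize_mul A F hA hF, map_mul]
  rfl

section RationalPair
variable {d : ℕ} {F G : ℚ[X]}

theorem NoCommonZero.isCoprime (hF : F.natDegree ≤ d) (hG : G.natDegree ≤ d)
    (hnz : NoCommonZero d F G) : IsCoprime F G := by
  refine (isCoprime_iff_aeval_ne_zero_of_isAlgClosed (k := ℚ) (K := ℂ) F G).mpr ?_
  intro z
  by_contra! h
  have := hnz (z, 1) (Prod.ext (by simpa [pairMap, formEval_one_right hF] using h.1)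
    (by simpa [pairMap, formEval_one_right hG] using h.2))
  simp at this

theorem natDegree_reflect_le_self (hF : F.natDegree ≤ d) : (reflect d F).natDegree ≤ d :=
  (natDegree_reflect_le).trans (max_le le_rfl hF)

theorem pairMap_reflect_swap {R : Type*} [CommRing R] [Algebra ℚ R] (P : R × R) :
    pairMap d (reflect d G) (reflect d F) P.swap = (pairMap d F G P).swap := by
  simp [pairMap, formEval_reflect]

theorem NoCommonZero.reflect (hnz : NoCommonZero d F G) :
    NoCommonZero d (reflect d G) (reflect d F) := by
  intro P hP
  rw [← Prod.swap_swap P, pairMap_reflect_swap] at hP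
  have := hnz P.swap (Prod.ext (congrArg Prod.snd hP) (congrArg Prod.fst hP))
  exact Prod.ext (congrArg Prod.snd this) (congrArg Prod.fst this)

theorem exists_bezout_form (hF : F.natDegree ≤ d) (hG : G.natDegree ≤ d)
    (hnz : NoCommonZero d F G) : ∃ n₀ : ℕ, ∀ n, n₀ ≤ n → ∃ A B : ℚ[X], ∀ a b : ℚ,
      formEval n A a b * formEval d F a b + formEval n B a b * formEval d G a b = b ^ (n + d) := by
  obtain ⟨A, B, h⟩ := hnz.isCoprime hF hG
  refine ⟨max A.natDegree B.natDegree, fun n hn => ⟨A, B, fun a b => ?_⟩⟩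
  rw [← formEval_mul ((le_max_left _ _).trans hn) hF, ← formEval_mul ((le_max_right _ _).trans hn)
    hG, ← formEval_add, h]
  simp [formEval]

/-- The height of a rational point of the projective line in homogeneous coordinates. -/
noncomputable def pairHeight (P : ℚ × ℚ) : ℝ := Height.logHeight ![P.1, P.2]

theorem pairHeight_eq (P : ℚ × ℚ) : pairHeight P = Height.logHeight₁ (P.1 / P.2) :=
  (Height.logHeight₁_div_eq_logHeight _ _).symm

theorem pairHeight_nonneg (P : ℚ × ℚ) : 0 ≤ pairHeight P := by
  rw [pairHeight_eq]; exact Height.zero_le_logHeight₁ _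

theorem exists_le_pairHeight_pairMap (hF : F.natDegree ≤ d) (hG : G.natDegree ≤ d)
    (hnz : NoCommonZero d F G) :
    ∃ K : ℝ, ∀ P : ℚ × ℚ, d * pairHeight P - K ≤ pairHeight (pairMap d F G P) := by
  obtain ⟨n₀, h₀⟩ := exists_bezout_form hF hG hnz
  obtain ⟨n₁, h₁⟩ := exists_bezout_form (natDegree_reflect_le_self hG)
    (natDegree_reflect_le_self hF) hnz.reflect
  obtain ⟨A, B, hAB⟩ := h₀ (max n₀ n₁) (le_max_left _ _)
  obtain ⟨A', B', hAB'⟩ := h₁ (max n₀ n₁) (le_max_right _ _)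
  set n := max n₀ n₁
  obtain ⟨K, hK⟩ := Height.logHeight_eval_ge' (K := ℚ) (M := n) (N := d)
    (q := fun ij : Fin 2 × Fin 2 => ((![![reflect n B', reflect n A'], ![A, B]] :
      Fin 2 → Fin 2 → ℚ[X]) ij.1 ij.2).homogenize n) (fun _ => isHomogeneous_homogenize _)
  refine ⟨-K, fun P => ?_⟩
  have := hK (fun j => ((![F, G] : Fin 2 → ℚ[X]) j).homogenize d) (x := ![P.1, P.2]) ?_
  · rw [sub_neg_eq_add, add_comm]
    refine this.trans_eq ?_
    rw [pairHeight]
    congr 1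
    funext j
    fin_cases j <;> simp [pairMap, formEval, MvPolynomial.aeval_eq_eval]
  · intro k
    have e₁ := hAB P.1 P.2
    have e₂ := hAB' P.2 P.1
    rw [formEval_reflect, formEval_reflect, ← formEval_reflect n A', ← formEval_reflect n B'] at e₂
    simp only [formEval, MvPolynomial.aeval_eq_eval] at e₁ e₂
    rw [Fin.sum_univ_two]
    fin_cases k
    · simpa [add_comm] using e₂
    · simpa using e₁

theorem exists_le_pairHeight_iterate (hF : F.natDegree ≤ d) (hG : G.natDegree ≤ d)
    (hnz : NoCommonZero d F G) (m : ℕ) :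
    ∃ K : ℝ, ∀ P : ℚ × ℚ, (d ^ m : ℕ) * pairHeight P - K ≤
      pairHeight ((pairMap d F G)^[m] P) := by
  obtain ⟨K, hK⟩ := exists_le_pairHeight_pairMap hF hG hnz
  induction m with
  | zero => exact ⟨0, fun P => by simp⟩
  | succ m ih =>
    obtain ⟨K', hK'⟩ := ih
    refine ⟨d * K' + K, fun P => ?_⟩
    rw [Function.iterate_succ_apply']
    refine le_trans ?_ (hK _)
    have := mul_le_mul_of_nonneg_left (hK' P) (Nat.cast_nonneg (α := ℝ) d)
    push_cast at this ⊢
    rw [pow_succ]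
    linarith

theorem exists_small_exponent (hd : 2 ≤ d) {ε : ℝ} (hε : 0 < ε) : ∃ q s : ℕ,
    (((d ^ 2 * (d - 1)) ^ q : ℕ) * (s + 1) + (d ^ (3 * q) : ℕ) / (s + 1) : ℝ) ≤
      ε * (d ^ (3 * q) : ℕ) := by
  obtain ⟨s, hs⟩ := exists_nat_one_div_lt (half_pos hε)
  have hd0 : (0 : ℝ) < d := by exact_mod_cast (by omega : 0 < d)
  have hlt : ((d : ℝ) - 1) / d < 1 := by rw [div_lt_one hd0]; linarith
  have hnn : 0 ≤ ((d : ℝ) - 1) / d := by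
    have : (2 : ℝ) ≤ d := by exact_mod_cast hd
    exact div_nonneg (by linarith) hd0.le
  obtain ⟨q, hq⟩ := exists_pow_lt_of_lt_one (show 0 < ε / 2 / (s + 1) by positivity) hlt
  refine ⟨q, s, ?_⟩
  have h1 : (((d ^ 2 * (d - 1)) ^ q : ℕ) : ℝ) = (((d : ℝ) - 1) / d) ^ q * (d : ℝ) ^ (3 * q) := by
    push_cast [Nat.cast_sub (show 1 ≤ d by omega)]
    rw [pow_mul (d : ℝ) 3 q, ← mul_pow]
    congr 1
    field_simp
  have hN : (0 : ℝ) < (d : ℝ) ^ (3 * q) := by positivity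
  rw [h1]
  push_cast
  rw [lt_div_iff₀ (by positivity)] at hq
  calc _ = ((((d : ℝ) - 1) / d) ^ q * (s + 1) + 1 / (s + 1)) * (d : ℝ) ^ (3 * q) := by ring
    _ ≤ (ε / 2 + ε / 2) * (d : ℝ) ^ (3 * q) := by gcongr
    _ = _ := by ring

theorem pairMap_iterate_div (m : ℕ) {P : ℚ × ℚ} (hP : P.2 ≠ 0) :
    (pairMap d F G)^[m] P = (P.2 ^ d ^ m * ((pairMap d F G)^[m] (P.1 / P.2, 1)).1,
      P.2 ^ d ^ m * ((pairMap d F G)^[m] (P.1 / P.2, 1)).2) := by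
  rw [← pairMap_iterate_mul, mul_one, mul_div_cancel₀ _ hP]

/-- Along an orbit of heights tending to infinity, the logarithmic size of the points is small
compared with the height. -/
theorem eventually_log_le (hd : 2 ≤ d) (hF : F.natDegree ≤ d) (hG : G.natDegree ≤ d)
    (hnz : NoCommonZero d F G) (hpow : NotPurePower d F G) {P : ℚ × ℚ}
    (hne : ∀ᶠ n in atTop, ((pairMap d F G)^[n] P).2 ≠ 0)
    (hh : Tendsto (fun n => pairHeight ((pairMap d F G)^[n] P)) atTop atTop) {ε : ℝ}
    (hε : 0 < ε) : ∀ᶠ n in atTop,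
      Real.log |((((pairMap d F G)^[n] P).1 / ((pairMap d F G)^[n] P).2 : ℚ) : ℝ)| ≤
        ε * pairHeight ((pairMap d F G)^[n] P) := by
  obtain ⟨q, s, hqs⟩ := exists_small_exponent hd (half_pos hε)
  obtain ⟨K, hK, H₀, hbound⟩ := exists_iterate_bound hd hF hG hnz hpow q s
  obtain ⟨C', hC'⟩ := exists_le_pairHeight_iterate hF hG hnz (3 * q)
  set m := 3 * q
  set N := d ^ m
  set ω : ℝ := ((d ^ 2 * (d - 1)) ^ q : ℕ) * (s + 1) + N / (s + 1) with hω
  have hω0 : 0 ≤ ω := by positivity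
  have hlarge : ∀ᶠ n in atTop, Real.log (max H₀ 1) ≤ pairHeight ((pairMap d F G)^[n] P) :=
    hh.eventually_ge_atTop _
  have hlarge' : ∀ᶠ n in atTop, Real.log K + ε / 2 * C' ≤
      ε / 2 * pairHeight ((pairMap d F G)^[n] P) :=
    (hh.const_mul_atTop (half_pos hε)).eventually_ge_atTop _
  have hshift : ∀ᶠ n in atTop,
      Real.log |((((pairMap d F G)^[n + m] P).1 / ((pairMap d F G)^[n + m] P).2 : ℚ) : ℝ)| ≤
        ε * pairHeight ((pairMap d F G)^[n + m] P) := by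
    filter_upwards [hne, (tendsto_add_atTop_nat m).eventually hne, hlarge,
      (tendsto_add_atTop_nat m).eventually hlarge'] with n h1 h2 h3 h4
    have hiter : (pairMap d F G)^[n + m] P = (pairMap d F G)^[m] ((pairMap d F G)^[n] P) := by
      rw [add_comm, Function.iterate_add_apply]
    rw [hiter] at h2 h4 ⊢
    set Q := (pairMap d F G)^[n] P
    have hht := hC' Q
    set x := Q.1 / Q.2 with hx
    have hratio : ((pairMap d F G)^[m] Q).1 / ((pairMap d F G)^[m] Q).2 =
        ((pairMap d F G)^[m] (x, 1)).1 / ((pairMap d F G)^[m] (x, 1)).2 := by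
      rw [pairMap_iterate_div m h1]
      exact mul_div_mul_left _ _ (pow_ne_zero _ h1)
    have h2' : ((pairMap d F G)^[m] (x, 1)).2 ≠ 0 := by
      rw [pairMap_iterate_div m h1] at h2
      exact right_ne_zero_of_mul h2
    have hpos : (0 : ℝ) < |((((pairMap d F G)^[m] (x, 1)).2 : ℚ) : ℝ)| := by
      rw [abs_pos]; exact_mod_cast h2'
    have hHx : pairHeight Q = Real.log (Height.mulHeight₁ x) := by
      rw [pairHeight_eq, Height.logHeight₁_eq_log_mulHeight₁]
    have hHpos : 0 < Height.mulHeight₁ x := Height.mulHeight₁_pos x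
    have hH₀ : H₀ ≤ Height.mulHeight₁ x := by
      rw [hHx] at h3
      exact (le_max_left _ _).trans ((Real.log_le_log_iff (by positivity) hHpos).mp h3)
    have hb := hbound x hH₀ h2'
    rw [hratio]
    set h' := pairHeight ((pairMap d F G)^[m] Q) with hh'
    have hh'0 : 0 ≤ h' := pairHeight_nonneg _
    by_cases hU : ((pairMap d F G)^[m] (x, 1)).1 = 0
    · rw [hU, zero_div, Rat.cast_zero, abs_zero, Real.log_zero]
      positivity
    have hUpos : (0 : ℝ) < |((((pairMap d F G)^[m] (x, 1)).1 : ℚ) : ℝ)| := by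
      rw [abs_pos]; exact_mod_cast hU
    rw [Rat.cast_div, abs_div]
    rw [← div_le_iff₀ hpos] at hb
    calc _ ≤ Real.log (K * Height.mulHeight₁ x ^ ω) :=
          Real.log_le_log (div_pos hUpos hpos) hb
      _ = Real.log K + ω * pairHeight Q := by
          rw [Real.log_mul hK.ne' (Real.rpow_pos_of_pos hHpos _).ne', Real.log_rpow hHpos, hHx]
      _ ≤ Real.log K + ε / 2 * N * pairHeight Q := by
          have := pairHeight_nonneg Q
          gcongr
      _ ≤ Real.log K + ε / 2 * (h' + C') := by
          rw [mul_assoc]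
          gcongr
          linarith
      _ ≤ ε * h' := by linarith
  obtain ⟨n₀, h⟩ := eventually_atTop.mp hshift
  refine eventually_atTop.mpr ⟨n₀ + m, fun n hn => ?_⟩
  have := h (n - m) (by omega)
  rwa [Nat.sub_add_cancel (by omega)] at this

end RationalPair

section RatFuncIterate
variable {K : Type*} [Field K]

theorem formEval_eq_mul_aeval {R : Type*} [Field R] [Algebra K R] {d : ℕ} {F : K[X]}
    (hF : F.natDegree ≤ d) (a : R) {b : R} (hb : b ≠ 0) :
    formEval d F a b = b ^ d * aeval (a / b) F := by
  rw [← formEval_one_right hF, ← formEval_mul_mul, mul_div_cancel₀ _ hb, mul_one]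

theorem formEval_zero_right {R : Type*} [CommRing R] [Algebra K R] (d : ℕ) (F : K[X]) (a : R) :
    formEval d F a 0 = algebraMap K R (F.coeff d) * a ^ d := by
  rw [formEval_eq_sum, Finset.sum_range_succ, Finset.sum_eq_zero, Nat.sub_self, pow_zero, zero_add,
    mul_one]
  intro i hi
  rw [Finset.mem_range] at hi
  rw [zero_pow (by omega), mul_zero]

variable {f : RatFunc K} {d : ℕ}

theorem rfComp_div (hn : f.num.natDegree ≤ d) (hd : f.denom.natDegree ≤ d) (a : RatFunc K)
    {b : RatFunc K} (hb : b ≠ 0) :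
    rfComp f (a / b) = formEval d f.num a b / formEval d f.denom a b := by
  rw [formEval_eq_mul_aeval hn a hb, formEval_eq_mul_aeval hd a hb,
    mul_div_mul_left _ _ (pow_ne_zero d hb), rfComp]

theorem aeval_X_eq (p : K[X]) :
    aeval (RatFunc.X : RatFunc K) p = algebraMap K[X] (RatFunc K) p := by
  rw [← RatFunc.algebraMap_X, aeval_algebraMap_apply, aeval_X_left_apply]

theorem algebraMap_pairMap_iterate (F G : K[X]) (m : ℕ) (U V : K[X]) :
    (algebraMap K[X] (RatFunc K) ((pairMap d F G)^[m] (U, V)).1,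
      algebraMap K[X] (RatFunc K) ((pairMap d F G)^[m] (U, V)).2) =
    (pairMap d F G)^[m] (algebraMap K[X] (RatFunc K) U, algebraMap K[X] (RatFunc K) V) := by
  have := map_pairMap_iterate (IsScalarTower.toAlgHom K K[X] (RatFunc K)) d F G m (U, V)
  simpa [Prod.map] using this

theorem rfIter_two_eq (hn : f.num.natDegree ≤ d) (hd : f.denom.natDegree ≤ d) :
    rfIter f 2 =
      algebraMap K[X] (RatFunc K) ((pairMap d f.num f.denom)^[2] (X, 1)).1 /
        algebraMap K[X] (RatFunc K) ((pairMap d f.num f.denom)^[2] (X, 1)).2 := by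
  have hiter := algebraMap_pairMap_iterate (d := d) f.num f.denom 2 X 1
  have h1 := congrArg Prod.fst hiter
  have h2 := congrArg Prod.snd hiter
  simp only [RatFunc.algebraMap_X, map_one] at h1 h2
  rw [h1, h2]
  have hden : formEval d f.denom (RatFunc.X : RatFunc K) 1 ≠ 0 := by
    rw [formEval_one_right hd, aeval_X_eq]
    exact RatFunc.algebraMap_ne_zero f.denom_ne_zero
  change rfComp f (rfComp f RatFunc.X) = _
  conv_lhs => rw [← div_one (RatFunc.X : RatFunc K), rfComp_div hn hd _ one_ne_zero,
    rfComp_div hn hd _ hden]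
  rfl

theorem rfIter_two_isPoly (hn : f.num.natDegree ≤ d) (hd : f.denom.natDegree ≤ d) {c : K}
    (h : ((pairMap d f.num f.denom)^[2] ((X : K[X]), (1 : K[X]))).2 = C c) :
    (rfIter f 2).IsPoly := by
  refine ⟨C c⁻¹ * ((pairMap d f.num f.denom)^[2] (X, 1)).1, ?_⟩
  rw [rfIter_two_eq hn hd, h, map_mul, RatFunc.algebraMap_C, RatFunc.algebraMap_C, map_inv₀,
    div_eq_inv_mul]

theorem aeval_inv_X_ne_zero {p : K[X]} (hp : p ≠ 0) :
    aeval (RatFunc.X⁻¹ : RatFunc K) p ≠ 0 := by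
  intro h
  have h1 := formEval_eq_mul_aeval (R := RatFunc K) (le_refl p.natDegree) 1 RatFunc.X_ne_zero
  rw [one_div, h, mul_zero, ← formEval_reflect,
    formEval_one_right ((natDegree_reflect_le).trans (max_le le_rfl le_rfl)), aeval_X_eq,
    map_eq_zero_iff _ (RatFunc.algebraMap_injective K), reflect_eq_zero_iff] at h1
  exact hp h1

theorem rfComp_algebraMap_div {A B : K[X]} (hB : B ≠ 0) :
    rfComp (algebraMap K[X] (RatFunc K) A / algebraMap K[X] (RatFunc K) B) RatFunc.X⁻¹ =
      aeval (RatFunc.X⁻¹ : RatFunc K) A / aeval (RatFunc.X⁻¹ : RatFunc K) B := by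
  have h := RatFunc.num_div_denom (algebraMap K[X] (RatFunc K) A / algebraMap K[X] (RatFunc K) B)
  set r := algebraMap K[X] (RatFunc K) A / algebraMap K[X] (RatFunc K) B with hr
  rw [rfComp, div_eq_div_iff (aeval_inv_X_ne_zero r.denom_ne_zero) (aeval_inv_X_ne_zero hB),
    ← map_mul, ← map_mul]
  congr 1
  rw [hr, div_eq_div_iff (RatFunc.algebraMap_ne_zero r.denom_ne_zero)
    (RatFunc.algebraMap_ne_zero hB), ← map_mul, ← map_mul] at h
  exact RatFunc.algebraMap_injective K h

theorem rfIter_two_conj_isPoly (hn : f.num.natDegree ≤ d) (hd : f.denom.natDegree ≤ d) {c : K}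
    (h : ((pairMap d f.num f.denom)^[2] ((1 : K[X]), (X : K[X]))).1 = C c) :
    ((rfComp (rfIter f 2) (RatFunc.X)⁻¹)⁻¹).IsPoly := by
  rw [rfIter_two_eq hn hd]
  by_cases hV : ((pairMap d f.num f.denom)^[2] ((X : K[X]), (1 : K[X]))).2 = 0
  · refine ⟨0, ?_⟩
    rw [hV, map_zero, div_zero]
    simp [rfComp]
  rw [rfComp_algebraMap_div hV]
  have hiter := algebraMap_pairMap_iterate (d := d) f.num f.denom 2 1 X
  rw [RatFunc.algebraMap_X, map_one] at hiter
  have heval := map_pairMap_iterate (aeval (R := K) (RatFunc.X⁻¹ : RatFunc K)) d f.num f.denom 2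
    (X, 1)
  simp only [Prod.map, aeval_X, map_one] at heval
  have hscale := pairMap_iterate_mul d f.num f.denom 2 (RatFunc.X : RatFunc K) RatFunc.X⁻¹ 1
  rw [mul_inv_cancel₀ RatFunc.X_ne_zero, mul_one, ← hiter, ← heval] at hscale
  have h1 := congrArg Prod.fst hscale
  have h2 := congrArg Prod.snd hscale
  dsimp only at h1 h2
  refine ⟨C c⁻¹ * ((pairMap d f.num f.denom)^[2] (1, X)).2, ?_⟩
  rw [inv_div, ← mul_div_mul_left _ _ (pow_ne_zero (d ^ 2) (RatFunc.X_ne_zero (K := K))), ← h1,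
    ← h2, h, map_mul, RatFunc.algebraMap_C, RatFunc.algebraMap_C, map_inv₀, div_eq_inv_mul]

end RatFuncIterate

theorem exists_pairMap_iterate_snd_eq_C {d : ℕ} {F G : ℚ[X]} {c : ℂ}
    (h : ∀ a b : ℂ, ((pairMap d F G)^[2] (a, b)).2 = c * b ^ (d * d)) :
    ∃ c₀ : ℚ, ((pairMap d F G)^[2] ((X : ℚ[X]), (1 : ℚ[X]))).2 = C c₀ := by
  set p := ((pairMap d F G)^[2] ((X : ℚ[X]), (1 : ℚ[X]))).2 with hp
  have hev (z : ℂ) : aeval z p = c := by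
    have := congrArg Prod.snd (map_pairMap_iterate (aeval (R := ℚ) z) d F G 2 (X, 1))
    simp only [Prod.map, aeval_X, map_one] at this
    rw [hp, this, h, one_pow, mul_one]
  have hmap : p.map (algebraMap ℚ ℂ) = C c := by
    refine funext fun z => ?_
    rw [eval_map_algebraMap, hev, eval_C]
  have hdeg : p.natDegree = 0 := by
    rw [← natDegree_map (algebraMap ℚ ℂ), hmap, natDegree_C]
  exact ⟨_, eq_C_of_natDegree_eq_zero hdeg⟩

section ProjectiveLine
variable {f : RatFunc ℚ} {d : ℕ}

theorem notPurePower_num_denom (hn : f.num.natDegree ≤ d) (hd : f.denom.natDegree ≤ d)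
    (hpoly : ¬ (rfIter f 2).IsPoly) : NotPurePower d f.num f.denom := by
  rintro ⟨c, h⟩
  obtain ⟨c₀, h₀⟩ := exists_pairMap_iterate_snd_eq_C h
  exact hpoly (rfIter_two_isPoly hn hd h₀)

theorem pairMap_reflect_iterate_swap {R : Type*} [CommRing R] [Algebra ℚ R] (F G : ℚ[X]) (n : ℕ)
    (P : R × R) : (pairMap d (reflect d G) (reflect d F))^[n] P.swap =
      ((pairMap d F G)^[n] P).swap :=
  (Function.Semiconj.iterate_right (f := Prod.swap)
    (fun Q => (pairMap_reflect_swap Q).symm) n P).symm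

theorem notPurePower_reflect (hn : f.num.natDegree ≤ d) (hd : f.denom.natDegree ≤ d)
    (hpoly : ¬ ((rfComp (rfIter f 2) (RatFunc.X)⁻¹)⁻¹).IsPoly) :
    NotPurePower d (reflect d f.denom) (reflect d f.num) := by
  rintro ⟨c, h⟩
  obtain ⟨c₀, h₀⟩ := exists_pairMap_iterate_snd_eq_C h
  have := pairMap_reflect_iterate_swap (d := d) f.num f.denom 2 ((1 : ℚ[X]), (X : ℚ[X]))
  rw [Prod.swap_prod_mk] at this
  rw [this] at h₀
  exact hpoly (rfIter_two_conj_isPoly hn hd h₀)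

theorem noCommonZero_num_denom (f : RatFunc ℚ) :
    NoCommonZero (max f.num.natDegree f.denom.natDegree) f.num f.denom := by
  rintro ⟨a, b⟩ h
  have h1 : formEval _ f.num a b = 0 := congrArg Prod.fst h
  have h2 : formEval _ f.denom a b = 0 := congrArg Prod.snd h
  by_cases hb : b = 0
  · subst hb
    rw [formEval_zero_right] at h1 h2
    by_cases ha : a = 0
    · rw [ha]; rfl
    have key (p : ℚ[X]) (n : ℕ) (hp : algebraMap ℚ ℂ (p.coeff n) * a ^ n = 0) :
        p.coeff n = 0 := by
      simpa [ha] using hp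
    replace h1 := key _ _ h1
    replace h2 := key _ _ h2
    exfalso
    rcases le_total f.num.natDegree f.denom.natDegree with hle | hle
    · rw [max_eq_right hle, coeff_natDegree, leadingCoeff_eq_zero] at h2
      exact f.denom_ne_zero h2
    · rw [max_eq_left hle] at h1 h2
      rw [coeff_natDegree, leadingCoeff_eq_zero] at h1
      have hd : f.denom.natDegree = 0 := by simpa [h1] using hle
      rw [h1, natDegree_zero, ← hd, coeff_natDegree, leadingCoeff_eq_zero] at h2
      exact f.denom_ne_zero h2
  · rw [formEval_eq_mul_aeval (le_max_left _ _) a hb, mul_eq_zero_iff_left (pow_ne_zero _ hb)] at h1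
    rw [formEval_eq_mul_aeval (le_max_right _ _) a hb,
      mul_eq_zero_iff_left (pow_ne_zero _ hb)] at h2
    have := (isCoprime_iff_aeval_ne_zero_of_isAlgClosed (k := ℚ) (K := ℂ) _ _).mp
      f.isCoprime_num_denom (a / b)
    simp [h1, h2] at this

theorem NoCommonZero.iterate_ne_zero {F G : ℚ[X]} (hnz : NoCommonZero d F G) {P : ℚ × ℚ}
    (hP : P ≠ 0) (n : ℕ) : (pairMap d F G)^[n] P ≠ 0 := by
  induction n with
  | zero => exact hP
  | succ n ih =>
    rw [Function.iterate_succ_apply']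
    intro h
    apply ih
    have := map_pairMap (Algebra.ofId ℚ ℂ) d F G ((pairMap d F G)^[n] P)
    rw [h] at this
    have h0 := hnz _ (this.symm.trans (Prod.ext (map_zero _) (map_zero _)))
    have h1 := congrArg Prod.fst h0
    have h2 := congrArg Prod.snd h0
    exact Prod.ext (by simpa [Algebra.ofId_apply] using h1) (by simpa [Algebra.ofId_apply] using h2)

/-- The point of the projective line with given homogeneous coordinates. -/
noncomputable def toP1 (P : ℚ × ℚ) : Option ℚ := if P.2 = 0 then none else some (P.1 / P.2)

theorem toP1_of_eq_zero {a b : ℚ} (hb : b = 0) : toP1 (a, b) = none := if_pos hb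

theorem toP1_of_ne_zero {a b : ℚ} (hb : b ≠ 0) : toP1 (a, b) = some (a / b) := if_neg hb

theorem toP1_pairMap (f : RatFunc ℚ) {P : ℚ × ℚ} (hP : P ≠ 0) :
    toP1 (pairMap (max f.num.natDegree f.denom.natDegree) f.num f.denom P) =
      P1map f (toP1 P) := by
  obtain ⟨a, b⟩ := P
  rw [pairMap]
  by_cases hb : b = 0
  · subst hb
    have ha : a ≠ 0 := fun ha => hP (by rw [ha]; rfl)
    rw [toP1_of_eq_zero rfl, P1map]
    simp only [formEval_zero_right, eq_ratCast, Rat.cast_id]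
    rcases lt_trichotomy f.denom.natDegree f.num.natDegree with h | h | h
    · rw [if_pos h, max_eq_left h.le, coeff_eq_zero_of_natDegree_lt h, zero_mul,
        toP1_of_eq_zero rfl]
    · have h2 : f.denom.coeff f.num.natDegree ≠ 0 := by
        rw [← h, coeff_natDegree, leadingCoeff_ne_zero]; exact f.denom_ne_zero
      rw [if_neg (by lia), if_neg (by lia), max_eq_left h.le,
        toP1_of_ne_zero (mul_ne_zero h2 (pow_ne_zero _ ha)),
        mul_div_mul_right _ _ (pow_ne_zero _ ha), coeff_natDegree, ← h, coeff_natDegree]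
    · have h2 : f.denom.coeff f.denom.natDegree ≠ 0 := by
        rw [coeff_natDegree, leadingCoeff_ne_zero]; exact f.denom_ne_zero
      rw [if_neg (by lia), if_pos h, max_eq_right h.le,
        toP1_of_ne_zero (mul_ne_zero h2 (pow_ne_zero _ ha)), coeff_eq_zero_of_natDegree_lt h,
        zero_mul, zero_div]
  · rw [toP1_of_ne_zero hb, P1map, formEval_eq_mul_aeval (le_max_left _ _) a hb,
      formEval_eq_mul_aeval (le_max_right _ _) a hb, coe_aeval_eq_eval]
    by_cases hv : f.denom.eval (a / b) = 0
    · rw [if_pos hv, toP1_of_eq_zero (by rw [hv, mul_zero])]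
    · rw [if_neg hv, toP1_of_ne_zero (mul_ne_zero (pow_ne_zero _ hb) hv),
        mul_div_mul_left _ _ (pow_ne_zero _ hb)]

theorem toP1_iterate (f : RatFunc ℚ) (α : ℚ) (n : ℕ) :
    toP1 ((pairMap (max f.num.natDegree f.denom.natDegree) f.num f.denom)^[n] (α, 1)) =
      (P1map f)^[n] (some α) := by
  induction n with
  | zero => simp [toP1]
  | succ n ih =>
    rw [Function.iterate_succ_apply', Function.iterate_succ_apply', ← ih]
    exact toP1_pairMap f ((noCommonZero_num_denom f).iterate_ne_zero (by simp) n)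

theorem injective_iterate_of_infinite {β : Type*} {g : β → β} {x : β}
    (h : {y | ∃ n : ℕ, g^[n] x = y}.Infinite) : Function.Injective fun n => g^[n] x := by
  by_contra hinj
  simp only [Function.Injective, not_forall] at hinj
  obtain ⟨i, j, hij, hne⟩ := hinj
  wlog hlt : i < j generalizing i j
  · exact this j i hij.symm (Ne.symm hne) (by omega)
  refine h ((Set.finite_Iio j).image (fun n => g^[n] x) |>.subset ?_)
  rintro _ ⟨n, rfl⟩
  induction n using Nat.strong_induction_on with
  | _ n ih =>
    rcases lt_or_ge n j with hn | hn
    · exact ⟨n, hn, rfl⟩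
    · have : g^[n] x = g^[n - j + i] x := by
        conv_lhs => rw [← Nat.sub_add_cancel hn, Function.iterate_add_apply]
        rw [Function.iterate_add_apply]
        exact congrArg _ hij.symm
      rw [this]
      exact ih _ (by omega)

theorem tendsto_pairHeight_of_injective {P : ℕ → ℚ × ℚ}
    (hinj : Function.Injective fun n => toP1 (P n)) :
    Tendsto (fun n => pairHeight (P n)) atTop atTop := by
  rw [tendsto_atTop]
  intro B
  rw [← Nat.cofinite_eq_atTop]
  have hfin : (insert none (some '' {x : ℚ | Height.logHeight₁ x ≤ B})).Finite :=
    ((NumberField.finite_setOfPred_logHeight₁_le ℚ B).image _).insert _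
  refine (hfin.preimage hinj.injOn).subset fun n hn => ?_
  have hn : ¬ B ≤ pairHeight (P n) := hn
  rw [pairHeight_eq, not_le] at hn
  by_cases h : (P n).2 = 0
  · exact Or.inl (by simp [toP1, h])
  · exact Or.inr ⟨_, hn.le, by simp [toP1, h]⟩

theorem pairHeight_swap (P : ℚ × ℚ) : pairHeight P.swap = pairHeight P := by
  rw [pairHeight_eq, pairHeight_eq, ← Height.logHeight₁_inv, inv_div]
  rfl

end ProjectiveLine

theorem tendsto_div_of_abs_sub_le {a b : ℕ → ℝ} (ha : ∀ n, 0 ≤ a n)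
    (hb : ∀ n, 0 ≤ b n) (h : Tendsto (fun n => max (a n) (b n)) atTop atTop)
    (hab : ∀ ε > 0, ∀ᶠ n in atTop, |a n - b n| ≤ ε * max (a n) (b n)) :
    Tendsto (fun n => a n / b n) atTop (nhds 1) := by
  rw [Metric.tendsto_nhds]
  intro δ hδ
  have hε : 0 < min (δ / 4) (1 / 2) := by positivity
  filter_upwards [hab _ hε, h.eventually_gt_atTop 0] with n h1 h2
  have ha := ha n
  have hb := hb n
  set x := a n
  set y := b n
  set m := max x y
  have h3 : min (δ / 4) (1 / 2) * m ≤ 1 / 2 * m := by gcongr; exact min_le_right _ _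
  have h4 : min (δ / 4) (1 / 2) * m ≤ δ / 4 * m := by gcongr; exact min_le_left _ _
  have hm : m ≤ 2 * y := by
    rcases max_choice x y with hx | hx
    · have := (abs_le.mp (h1.trans h3)).2
      have hmx : m = x := hx
      linarith
    · have hmy : m = y := hx
      linarith
  have hy : 0 < y := by linarith
  rw [Real.dist_eq, div_sub_one hy.ne', abs_div, abs_of_pos hy, div_lt_iff₀ hy]
  calc _ ≤ δ / 4 * m := h1.trans h4
    _ ≤ δ / 4 * (2 * y) := by gcongr
    _ < δ * y := by nlinarith

theorem logHeight₁_eq_max_log {x : ℚ} (hx : x ≠ 0) :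
    Height.logHeight₁ x = max (Real.log |(x.num : ℝ)|) (Real.log x.den) := by
  have hn : (0 : ℝ) < |(x.num : ℝ)| := by simpa using hx
  have hd : (0 : ℝ) < x.den := by exact_mod_cast x.den_pos
  rw [Height.logHeight₁_eq_log_mulHeight₁, Rat.mulHeight₁_eq_max, Nat.cast_max, Nat.cast_natAbs,
    Int.cast_abs]
  rcases le_total |(x.num : ℝ)| x.den with h | h
  · rw [max_eq_right h, max_eq_right (Real.log_le_log hn h)]
  · rw [max_eq_left h, max_eq_left (Real.log_le_log hd h)]

theorem log_abs_eq_sub {x : ℚ} (hx : x ≠ 0) :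
    Real.log |(x : ℝ)| = Real.log |(x.num : ℝ)| - Real.log x.den := by
  have hn : |(x.num : ℝ)| ≠ 0 := by simpa using hx
  have hd : (x.den : ℝ) ≠ 0 := by exact_mod_cast x.den_ne_zero
  rw [Rat.cast_def, abs_div, Nat.abs_cast, Real.log_div hn hd]

/-- Integrality of orbits on the projective line, in homogeneous coordinates. -/
theorem eventually_abs_log_le {d : ℕ} {F G : ℚ[X]} (hd : 2 ≤ d) (hF : F.natDegree ≤ d)
    (hG : G.natDegree ≤ d) (hnz : NoCommonZero d F G) (hpow : NotPurePower d F G)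
    (hpow' : NotPurePower d (reflect d G) (reflect d F)) {P : ℚ × ℚ}
    (h1 : ∀ᶠ n in atTop, ((pairMap d F G)^[n] P).1 ≠ 0)
    (h2 : ∀ᶠ n in atTop, ((pairMap d F G)^[n] P).2 ≠ 0)
    (hh : Tendsto (fun n => pairHeight ((pairMap d F G)^[n] P)) atTop atTop) {ε : ℝ}
    (hε : 0 < ε) : ∀ᶠ n in atTop,
      abs (Real.log |((((pairMap d F G)^[n] P).1 / ((pairMap d F G)^[n] P).2 : ℚ) : ℝ)|) ≤
        ε * pairHeight ((pairMap d F G)^[n] P) := by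
  have hswap (n : ℕ) := pairMap_reflect_iterate_swap (d := d) F G n P
  have hlow := eventually_log_le hd (natDegree_reflect_le_self hG) (natDegree_reflect_le_self hF)
    hnz.reflect hpow' (P := P.swap) (by simpa only [hswap, Prod.snd_swap] using h1)
    (by simpa only [hswap, pairHeight_swap] using hh) hε
  filter_upwards [eventually_log_le hd hF hG hnz hpow h2 hh hε, hlow] with n hup hlow
  rw [hswap, pairHeight_swap, Prod.fst_swap, Prod.snd_swap, ← inv_div, Rat.cast_inv, abs_inv,
    Real.log_inv] at hlow
  exact abs_le.mpr ⟨by linarith, hup⟩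

end DynamicalSiegel

/-- dynamical Siegel theorem for P¹, Silverman: let f ∈ ℚ(X) have degree
≥ 2, with neither f²(X) nor (f²(X⁻¹))⁻¹ a polynomial, and let α ∈ ℚ be a wandering point
of f on P¹(ℚ). Then for all large n the point f^n(α) is a rational number, and writing
f^n(α) = A_n/B_n in lowest terms, log|A_n| / log|B_n| → 1 as n → ∞. -/
theorem dynamical_siegel_P1
    (f : RatFunc ℚ) (hdeg : 2 ≤ max f.num.natDegree f.denom.natDegree)
    (hpoly : ¬ (rfIter f 2).IsPoly)
    (hpoly' : ¬ ((rfComp (rfIter f 2) (RatFunc.X)⁻¹)⁻¹).IsPoly)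
    (α : ℚ)
    (hwander : {Q : Option ℚ | ∃ n : ℕ, (P1map f)^[n] (some α) = Q}.Infinite) :
    (∃ N₀ : ℕ, ∀ n : ℕ, N₀ ≤ n → ∃ x : ℚ, (P1map f)^[n] (some α) = some x) ∧
    Tendsto (fun n : ℕ =>
        ((P1map f)^[n] (some α)).elim (0 : ℝ)
          (fun x => Real.log |(x.num : ℝ)| / Real.log (x.den : ℝ)))
      atTop (nhds 1) := by
  have hnz := noCommonZero_num_denom f
  have hpow := notPurePower_num_denom (le_max_left _ _) (le_max_right _ _) hpoly
  have hpow' := notPurePower_reflect (le_max_left _ _) (le_max_right _ _) hpoly'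
  have horbit := toP1_iterate f α
  set d := max f.num.natDegree f.denom.natDegree
  set P : ℕ → ℚ × ℚ := fun n => (pairMap d f.num f.denom)^[n] (α, 1) with hP
  set x : ℕ → ℚ := fun n => (P n).1 / (P n).2 with hx
  have hinj : Function.Injective fun n => toP1 (P n) := by
    simpa only [hP, horbit] using injective_iterate_of_infinite hwander
  have hh : Tendsto (fun n => pairHeight (P n)) atTop atTop := tendsto_pairHeight_of_injective hinj
  have hev (y : Option ℚ) : ∀ᶠ n in atTop, toP1 (P n) ≠ y := by
    rw [← Nat.cofinite_eq_atTop]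
    exact hinj.tendsto_cofinite.eventually (Set.finite_singleton y).compl_mem_cofinite
  have h2 : ∀ᶠ n in atTop, (P n).2 ≠ 0 := by
    filter_upwards [hev none] with n hn h
    exact hn (by simp [toP1, h])
  have h1 : ∀ᶠ n in atTop, (P n).1 ≠ 0 := by
    filter_upwards [hev (some 0), h2] with n hn h2 h
    exact hn (by simp [toP1, h2, h])
  have hsome : ∀ᶠ n in atTop, (P1map f)^[n] (some α) = some (x n) := by
    filter_upwards [h2] with n hn
    rw [← horbit]
    exact if_neg hn
  have hx0 : ∀ᶠ n in atTop, x n ≠ 0 := by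
    filter_upwards [h1, h2] with n h1 h2
    exact div_ne_zero h1 h2
  have hht : ∀ᶠ n in atTop, pairHeight (P n) =
      max (Real.log |((x n).num : ℝ)|) (Real.log (x n).den) := by
    filter_upwards [hx0] with n hn
    rw [pairHeight_eq, logHeight₁_eq_max_log hn]
  constructor
  · obtain ⟨N, hN⟩ := eventually_atTop.mp hsome
    exact ⟨N, fun n hn => ⟨_, hN n hn⟩⟩
  have hlim : Tendsto (fun n => Real.log |((x n).num : ℝ)| / Real.log (x n).den) atTop
      (nhds 1) := by
    refine tendsto_div_of_abs_sub_le (fun n => ?_) (fun n => Real.log_natCast_nonneg _)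
      (hh.congr' hht) fun ε hε => ?_
    · rw [← Int.cast_abs, ← Nat.cast_natAbs]
      exact Real.log_natCast_nonneg _
    · filter_upwards [eventually_abs_log_le hdeg (le_max_left _ _) (le_max_right _ _) hnz hpow
        hpow' h1 h2 hh hε, hht, hx0] with n hn hht hx0
      rwa [← hht, ← log_abs_eq_sub hx0]
  refine hlim.congr' ?_
  filter_upwards [hsome] with n hn
  rw [hn]
  rfl
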